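/- For integers 0 ≤ m′ ≤ m ≤ n, the domain Δ_n^{m′,m} = {X ⊆ [n] : m′ ≤ |X| ≤ m} is w-pure, and its w-rank equals C(n+1,2) − C(n−m+1,2) − C(m′+1,2) + 1, where C(a,2) = a(a−1)/2. -/

import Mathlib

open Finset

/-- max of a finite set of naturals, with the convention `max0 ∅ = 0`. -/
def max0 (A : Finset ℕ) : ℕ := if h : A.Nonempty then A.max' h else 0

/-- min of a finite set of naturals, with the convention `min0 ∅ = 0`. -/
def min0 (A : Finset ℕ) : ℕ := if h : A.Nonempty then A.min' h else 0

/-- `A < B` : global dominating, i.e. `max A < min B` (with `min ∅ = max ∅ = 0`). -/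
def SetLT (A B : Finset ℕ) : Prop := max0 A < min0 B

/-- `A ⋖ B` : global dominating after cancelations, i.e. `(A − B) < (B − A)`. -/
def LessDot (A B : Finset ℕ) : Prop := SetLT (A \ B) (B \ A)

/-- `A ▷ B` (splitting): `A − B ≠ ∅` and `B − A` is a union of nonempty subsets
`B′, B″` with `B′ < (A − B) < B″`. -/
def Splits (A B : Finset ℕ) : Prop :=
  (A \ B).Nonempty ∧ ∃ B' B'' : Finset ℕ, B'.Nonempty ∧ B''.Nonempty ∧
    B' ∪ B'' = B \ A ∧ SetLT B' (A \ B) ∧ SetLT (A \ B) B''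

/-- `A` and `B` are strongly separated. -/
def StronglySep (A B : Finset ℕ) : Prop := LessDot A B ∨ LessDot B A ∨ A = B

/-- `A` and `B` are weakly separated. -/
def WeaklySep (A B : Finset ℕ) : Prop :=
  StronglySep A B ∨ (Splits A B ∧ B.card ≤ A.card) ∨ (Splits B A ∧ A.card ≤ B.card)

/-- a w-collection: members are pairwise weakly separated. -/
def IsWColl (F : Finset (Finset ℕ)) : Prop := ∀ A ∈ F, ∀ B ∈ F, WeaklySep A B

/-- a maximal w-collection in the domain `D`. -/
def IsMaxWColl (D : Set (Finset ℕ)) (F : Finset (Finset ℕ)) : Prop :=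
  ↑F ⊆ D ∧ IsWColl F ∧
    ∀ G : Finset (Finset ℕ), ↑G ⊆ D → IsWColl G → F ⊆ G → F = G

/-- the domain `D` is w-pure: all maximal w-collections in `D` have the same cardinality. -/
def WPure (D : Set (Finset ℕ)) : Prop :=
  ∀ F G : Finset (Finset ℕ), IsMaxWColl D F → IsMaxWColl D G → F.card = G.card

/-- an s-collection: members are pairwise strongly separated. -/
def IsSColl (F : Finset (Finset ℕ)) : Prop := ∀ A ∈ F, ∀ B ∈ F, StronglySep A B

/-- a maximal s-collection in the domain `D`. -/
def IsMaxSColl (D : Set (Finset ℕ)) (F : Finset (Finset ℕ)) : Prop :=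
  ↑F ⊆ D ∧ IsSColl F ∧
    ∀ G : Finset (Finset ℕ), ↑G ⊆ D → IsSColl G → F ⊆ G → F = G

/-- the domain `D` is s-pure: all maximal s-collections in `D` have the same cardinality. -/
def SPure (D : Set (Finset ℕ)) : Prop :=
  ∀ F G : Finset (Finset ℕ), IsMaxSColl D F → IsMaxSColl D G → F.card = G.card

namespace WSep

theorem exists_max_of_bdd {P : ℕ → Prop} (b : ℕ) (h : ∃ n, P n) (hb : ∀ n, P n → n ≤ b) :
    ∃ n, P n ∧ ∀ k, P k → k ≤ n := by
  classical
  obtain ⟨n, hn⟩ := h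
  exact ⟨Nat.findGreatest P b, Nat.findGreatest_spec (hb n hn) hn,
    fun k hk => Nat.le_findGreatest (hb k hk) hk⟩

variable {ι : Type*}

/-- A family of subsets `A X` of `[0, b]` whose pairwise differences do not cross, with labels
`M X` that are monotone along splittings. -/
structure Nodes (b : ℕ) (A M : ι → Set ℕ) : Prop where
  le : ∀ X, ∀ x ∈ A X, x ≤ b
  nc : ∀ X Y w₁ w₂ w₃ w₄, w₁ < w₂ → w₂ < w₃ → w₃ < w₄ → w₁ ∈ A X → w₁ ∉ A Y →
    w₂ ∈ A Y → w₂ ∉ A X → w₃ ∈ A X → w₃ ∉ A Y → w₄ ∈ A Y → w₄ ∉ A X → False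
  split : ∀ X Y u v z, u < v → v < z → u ∈ A Y → u ∉ A X → v ∈ A X → v ∉ A Y →
    z ∈ A Y → z ∉ A X → M Y ⊆ M X

/-- The reflection of a subset of `[0, b]`. -/
def flip (b : ℕ) (S : Set ℕ) : Set ℕ := {x | x ≤ b ∧ b - x ∈ S}

theorem sub_mem_flip {b x : ℕ} {S : Set ℕ} (hx : x ≤ b) : b - x ∈ flip b S ↔ x ∈ S := by
  have : b - (b - x) = x := by omega
  simp [flip, this]

theorem Nodes.flip {b : ℕ} {A M : ι → Set ℕ} (h : Nodes b A M) :
    Nodes b (fun X => WSep.flip b (A X)) M where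
  le X x hx := hx.1
  nc X Y w₁ w₂ w₃ w₄ h₁ h₂ h₃ a₁ a₂ a₃ a₄ a₅ a₆ a₇ a₈ := by
    have l₄ : w₄ ≤ b := a₇.1
    refine h.nc Y X (b - w₄) (b - w₃) (b - w₂) (b - w₁) (by omega) (by omega) (by omega)
      a₇.2 (fun k => a₈ ⟨l₄, k⟩) a₅.2 (fun k => a₆ ⟨by omega, k⟩) a₃.2
      (fun k => a₄ ⟨by omega, k⟩) a₁.2 (fun k => a₂ ⟨by omega, k⟩)
  split X Y u v z h₁ h₂ a₁ a₂ a₃ a₄ a₅ a₆ := by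
    have l : z ≤ b := a₅.1
    exact h.split X Y (b - z) (b - v) (b - u) (by omega) (by omega) a₅.2
      (fun k => a₆ ⟨l, k⟩) a₃.2 (fun k => a₄ ⟨by omega, k⟩) a₁.2 (fun k => a₂ ⟨by omega, k⟩)

/-- A sequence of overlapping gaps `(p i, q i)` of the sets `A (X i)` covering `[0, b]`. -/
structure Chain (b : ℕ) (A : ι → Set ℕ) (r : ℕ) (X : ℕ → ι) (p q : ℕ → ℕ) : Prop where
  lt : ∀ i ≤ r, p i < q i
  p_mem : ∀ i ≤ r, p i ∈ A (X i)
  q_mem : ∀ i ≤ r, q i ∈ A (X i)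
  gap : ∀ i ≤ r, ∀ x, p i < x → x < q i → x ∉ A (X i)
  p_zero : p 0 = 0
  q_last : q r = b
  p_lt : ∀ i < r, p i < p (i + 1)
  p_lt_q : ∀ i < r, p (i + 1) < q i
  q_lt : ∀ i < r, q i < q (i + 1)

theorem Chain.flip {b : ℕ} {A M : ι → Set ℕ} (hN : Nodes b A M) {r : ℕ} {X : ℕ → ι}
    {p q : ℕ → ℕ} (h : Chain b A r X p q) :
    Chain b (fun X => WSep.flip b (A X)) r (fun i => X (r - i)) (fun i => b - q (r - i))
      (fun i => b - p (r - i)) := by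
  have hq : ∀ i ≤ r, q i ≤ b := fun i hi => hN.le _ _ (h.q_mem i hi)
  have hp : ∀ i ≤ r, p i ≤ b := fun i hi => hN.le _ _ (h.p_mem i hi)
  refine ⟨?_, ?_, ?_, ?_, ?_, ?_, ?_, ?_, ?_⟩
  · intro i hi
    have := h.lt (r - i) (by omega)
    have := hq (r - i) (by omega)
    omega
  · intro i hi
    exact (sub_mem_flip (hq _ (by omega))).2 (h.q_mem _ (by omega))
  · intro i hi
    exact (sub_mem_flip (hp _ (by omega))).2 (h.p_mem _ (by omega))
  · intro i hi x h1 h2 hx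
    exact h.gap (r - i) (by omega) (b - x) (by omega) (by omega) hx.2
  · simp [h.q_last]
  · simp [h.p_zero]
  · intro i hi
    have e : r - i = r - (i + 1) + 1 := by omega
    have := h.q_lt (r - (i + 1)) (by omega)
    have := hq (r - i) (by omega)
    rw [← e] at *
    omega
  · intro i hi
    have e : r - i = r - (i + 1) + 1 := by omega
    have := h.p_lt_q (r - (i + 1)) (by omega)
    have := hq (r - (i + 1)) (by omega)
    have := hp (r - i) (by omega)
    rw [← e] at *
    omega
  · intro i hi
    have e : r - i = r - (i + 1) + 1 := by omega
    have := h.p_lt (r - (i + 1)) (by omega)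
    have := hp (r - i) (by omega)
    rw [← e] at *
    omega

/-- A sequence of splittings leading from a node to the node `K`. -/
inductive Strong (A : ι → Set ℕ) (K : ι) : ι → ℕ → ℕ → Prop
  | last {X : ι} {u v z : ℕ} : u < v → v < z → u ∈ A K → u ∉ A X → v ∈ A X → v ∉ A K →
      z ∈ A K → z ∉ A X → Strong A K X u v
  | cons {X Z : ι} {u v z u' v' : ℕ} : u < v → v < z → u ∈ A Z → u ∉ A X → v ∈ A X → v ∉ A Z →
      z ∈ A Z → z ∉ A X → Strong A K Z u' v' → u < u' → v < v' → Strong A K X u v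

variable {b : ℕ} {A M : ι → Set ℕ}

theorem Strong.subset (hN : Nodes b A M) {K X : ι} {u v : ℕ} (h : Strong A K X u v) :
    M K ⊆ M X := by
  induction h with
  | last h1 h2 a1 a2 a3 a4 a5 a6 => exact hN.split _ _ _ _ _ h1 h2 a1 a2 a3 a4 a5 a6
  | cons h1 h2 a1 a2 a3 a4 a5 a6 _ _ _ ih =>
    exact ih.trans (hN.split _ _ _ _ _ h1 h2 a1 a2 a3 a4 a5 a6)

theorem Strong.zero_mem (hN : Nodes b A M) {K X : ι} {u v : ℕ} (h : Strong A K X u v) :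
    0 < u → 0 ∈ A X → 0 ∈ A K := by
  induction h with
  | last h1 h2 a1 a2 a3 a4 a5 a6 =>
    intro hu h0
    by_contra hc
    exact hN.nc _ _ _ _ _ _ hu h1 h2 h0 hc a1 a2 a3 a4 a5 a6
  | cons h1 h2 a1 a2 a3 a4 a5 a6 _ hu' _ ih =>
    intro hu h0
    refine ih (by omega) ?_
    by_contra hc
    exact hN.nc _ _ _ _ _ _ hu h1 h2 h0 hc a1 a2 a3 a4 a5 a6

theorem Strong.extend (hN : Nodes b A M) {K Z : ι} {u' v' : ℕ} (hb : b ∈ A K)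
    (h : Strong A K Z u' v') : ∀ {X : ι} {u v : ℕ}, u < v → u ∈ A Z → u ∉ A X → v ∈ A X →
      v ∉ A Z → u < u' → v < v' → b ∉ A X → ∃ v'' ≥ v, Strong A K X u v'' := by
  induction h with
  | @last Z u' v' z' h1 h2 a1 a2 a3 a4 a5 a6 =>
    intro X u v huv c1 c2 c3 c4 huu hvv hbX
    by_cases hz : ∃ z > v, z ∈ A Z ∧ z ∉ A X
    · obtain ⟨z, hz1, hz2, hz3⟩ := hz
      exact ⟨v, le_rfl, .cons huv hz1 c1 c2 c3 c4 hz2 hz3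
        (.last h1 h2 a1 a2 a3 a4 a5 a6) huu hvv⟩
    · push Not at hz
      have huK : u ∈ A K := by
        by_contra hc
        exact hN.nc _ _ _ _ _ _ huu h1 h2 c1 hc a1 a2 a3 a4 a5 a6
      have := hN.le _ _ a5
      exact ⟨v', hvv.le, .last (by omega) (by omega : v' < b) huK c2 (hz _ hvv a3) a4 hb hbX⟩
  | @cons Z W u' v' z' u'' v'' h1 h2 a1 a2 a3 a4 a5 a6 hW huu' hvv' ih =>
    intro X u v huv c1 c2 c3 c4 huu hvv hbX
    by_cases hz : ∃ z > v, z ∈ A Z ∧ z ∉ A X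
    · obtain ⟨z, hz1, hz2, hz3⟩ := hz
      exact ⟨v, le_rfl, .cons huv hz1 c1 c2 c3 c4 hz2 hz3
        (.cons h1 h2 a1 a2 a3 a4 a5 a6 hW huu' hvv') huu hvv⟩
    · push Not at hz
      have huW : u ∈ A W := by
        by_contra hc
        exact hN.nc _ _ _ _ _ _ huu h1 h2 c1 hc a1 a2 a3 a4 a5 a6
      obtain ⟨w, hw, hs⟩ := ih (by omega : u < v') huW c2 (hz _ hvv a3) a4 (by omega) hvv' hbX
      exact ⟨w, by omega, hs⟩

variable {r : ℕ} {X : ℕ → ι} {p q : ℕ → ℕ}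

theorem Chain.next_p_notMem (h : Chain b A r X p q) {l : ℕ} (hl : l < r) :
    p (l + 1) ∉ A (X l) :=
  h.gap l hl.le _ (h.p_lt l hl) (h.p_lt_q l hl)

theorem Chain.q_notMem_next (h : Chain b A r X p q) {l : ℕ} (hl : l < r) :
    q l ∉ A (X (l + 1)) :=
  h.gap (l + 1) hl _ (h.p_lt_q l hl) (h.q_lt l hl)

theorem Chain.strong (hN : Nodes b A M) (h : Chain b A r X p q) {t : ℕ} (ht : t ≤ r)
    (hb : b ∈ A (X t)) : ∀ d l, l + d + 1 = t → (∀ x, l ≤ x → x < t → b ∉ A (X x)) →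
      ∃ v ≥ q l, Strong A (X t) (X l) (p (l + 1)) v := by
  intro d
  induction d with
  | zero =>
    intro l hl hx
    obtain rfl : t = l + 1 := by omega
    have hl' : l < r := by omega
    have hql : q l < q (l + 1) := h.q_lt l hl'
    have := hN.le _ _ (h.q_mem (l + 1) ht)
    exact ⟨q l, le_rfl, .last (h.p_lt_q l hl') (by omega : q l < b) (h.p_mem _ ht)
      (h.next_p_notMem hl') (h.q_mem _ hl'.le) (h.q_notMem_next hl') hb (hx l le_rfl (by omega))⟩
  | succ d ih =>
    intro l hl hx
    obtain ⟨v, hv, hs⟩ := ih (l + 1) (by omega) (fun x h1 h2 => hx x (by omega) h2)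
    have hl' : l < r := by omega
    have hql : q l < q (l + 1) := h.q_lt l hl'
    obtain ⟨w, hw, hs'⟩ := hs.extend hN hb (h.p_lt_q l hl') (h.p_mem _ (by omega))
      (h.next_p_notMem hl') (h.q_mem _ hl'.le) (h.q_notMem_next hl') (h.p_lt _ (by omega))
      (by omega) (hx l le_rfl (by omega))
    exact ⟨w, hw, hs'⟩

theorem Chain.subset_of_lt (hN : Nodes b A M) (h : Chain b A r X p q) {t l : ℕ} (ht : t ≤ r)
    (hl : l < t) (hb : b ∈ A (X t)) (hx : ∀ x, l ≤ x → x < t → b ∉ A (X x)) :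
    M (X t) ⊆ M (X l) := by
  obtain ⟨v, -, hs⟩ := h.strong hN ht hb (t - l - 1) l (by omega) hx
  exact hs.subset hN

theorem Chain.zero_mem_of_lt (hN : Nodes b A M) (h : Chain b A r X p q) {t l : ℕ} (ht : t ≤ r)
    (hl : l < t) (hb : b ∈ A (X t)) (hx : ∀ x, l ≤ x → x < t → b ∉ A (X x))
    (h0 : 0 ∈ A (X l)) : 0 ∈ A (X t) := by
  obtain ⟨v, -, hs⟩ := h.strong hN ht hb (t - l - 1) l (by omega) hx
  have := h.p_lt l (by omega)
  exact hs.zero_mem hN (by omega) h0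

end WSep

namespace WSep

variable {ι : Type*} {b : ℕ} {A M : ι → Set ℕ} {r : ℕ} {X : ℕ → ι} {p q : ℕ → ℕ}

theorem flip_subset_flip {S T : Set ℕ} (h : S ⊆ T) : flip b S ⊆ flip b T :=
  fun _ hx => ⟨hx.1, h hx.2⟩

theorem subset_of_flip {S T : Set ℕ} (hS : ∀ x ∈ S, x ≤ b) (h : flip b S ⊆ flip b T) : S ⊆ T :=
  fun x hx => (sub_mem_flip (hS x hx)).1 (h ((sub_mem_flip (hS x hx)).2 hx))

theorem zero_mem_flip {S : Set ℕ} : 0 ∈ flip b S ↔ b ∈ S := by simp [flip]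

theorem last_mem_flip {S : Set ℕ} : b ∈ flip b S ↔ 0 ∈ S := by simp [flip]

/-- A node contained in all nodes joining `0` to `b`, none of which is dominated by a nonempty
node inside it. -/
structure Obstructing (b : ℕ) (A M : ι → Set ℕ) (J : ι) : Prop where
  nonempty : (A J).Nonempty
  pos : ∀ e ∈ A J, 0 < e ∧ e < b
  sub : ∀ K, 0 ∈ A K → b ∈ A K → A J ⊆ A K
  not_le : ∀ K Y, 0 ∈ A K → b ∈ A K → (A Y).Nonempty → A Y ⊆ A J → ¬ M K ⊆ M Y

theorem Obstructing.flip {J : ι} (hN : Nodes b A M) (h : Obstructing b A M J) :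
    Obstructing b (fun X => WSep.flip b (A X)) M J where
  nonempty := by
    obtain ⟨x, hx⟩ := h.nonempty
    exact ⟨b - x, (sub_mem_flip (hN.le _ _ hx)).2 hx⟩
  pos e he := by
    have := h.pos _ he.2
    omega
  sub K h0 hb := flip_subset_flip (h.sub K (last_mem_flip.1 hb) (zero_mem_flip.1 h0))
  not_le K Y h0 hb hY hs := by
    obtain ⟨x, hx⟩ := hY
    exact h.not_le K Y (last_mem_flip.1 hb) (zero_mem_flip.1 h0) ⟨_, hx.2⟩
      (subset_of_flip (hN.le Y) hs)

/-- The `i`-th gap meets `S`. -/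
def Hits (S : Set ℕ) (p q : ℕ → ℕ) (i : ℕ) : Prop := ∃ e ∈ S, p i < e ∧ e < q i

variable {J : ι}

theorem Obstructing.not_hits (ho : Obstructing b A M J) (h : Chain b A r X p q) {i : ℕ}
    (hi : i ≤ r) (h0 : 0 ∈ A (X i)) (hb : b ∈ A (X i)) : ¬ Hits (A J) p q i := by
  rintro ⟨e, he, h1, h2⟩
  exact h.gap i hi e h1 h2 (ho.sub _ h0 hb he)

theorem Obstructing.side (hN : Nodes b A M) (ho : Obstructing b A M J) (h : Chain b A r X p q)
    {t l : ℕ} (ht : t ≤ r) (hl : l < t) (h0 : 0 ∈ A (X t)) (hb : b ∈ A (X t))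
    (hx : ∀ x, l ≤ x → x < t → b ∉ A (X x)) (hh : Hits (A J) p q l) :
    ((∀ w ∈ A (X l), w ≤ p l → w ∈ A J) ∧ ∃ z ∈ A (X l), q l ≤ z ∧ z ∉ A J) ∨
    ((∀ z ∈ A (X l), q l ≤ z → z ∈ A J) ∧ ∃ w ∈ A (X l), w ≤ p l ∧ w ∉ A J) := by
  obtain ⟨e, he, h1, h2⟩ := hh
  have hM := h.subset_of_lt hN ht hl hb hx
  have hgap := h.gap l (by omega)
  have hlr : ∀ w ∈ A (X l), w ≤ p l ∨ q l ≤ w := by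
    intro w hw
    by_contra! hc
    exact hgap w hc.1 hc.2 hw
  by_cases hw : ∃ w ∈ A (X l), w ≤ p l ∧ w ∉ A J
  · refine Or.inr ⟨fun z hz hqz => ?_, hw⟩
    by_contra hc
    obtain ⟨w, hw1, hw2, hw3⟩ := hw
    exact ho.not_le _ J h0 hb ho.nonempty subset_rfl
      (hM.trans (hN.split _ _ w e z (by omega) (by omega) hw1 hw3 he (hgap e h1 h2) hz hc))
  · push Not at hw
    refine Or.inl ⟨hw, ?_⟩
    by_contra! hc
    refine ho.not_le _ (X l) h0 hb ⟨_, h.p_mem l (by omega)⟩ (fun w hw' => ?_) hM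
    rcases hlr w hw' with h' | h'
    exacts [hw w hw' h', hc w hw' h']

theorem Obstructing.descent (hN : Nodes b A M) (ho : Obstructing b A M J)
    (h : Chain b A r X p q) {t c y : ℕ} (ht : t ≤ r) (h0 : 0 ∈ A (X t)) (hb : b ∈ A (X t))
    (hc0 : 0 ∈ A (X c)) (hcb : ∀ l, c ≤ l → l < t → Hits (A J) p q l → b ∉ A (X l))
    (hy : Hits (A J) p q y) (hcy : c ≤ y) (hyt : y < t)
    (hx : ∀ x, y ≤ x → x < t → b ∉ A (X x)) : False := by
  obtain ⟨i, ⟨hyi, hit, hi⟩, hmax⟩ := exists_max_of_bdd (P := fun i => y ≤ i ∧ i < t ∧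
    Hits (A J) p q i) t ⟨y, le_rfl, hyt, hy⟩ (fun n hn => hn.2.1.le)
  have key : ∀ l, c ≤ l → l < t → (∀ x, l ≤ x → x < t → b ∉ A (X x)) →
      (∀ w ∈ A (X l), w ≤ p l → w ∈ A J) → (∃ z ∈ A (X l), q l ≤ z ∧ z ∉ A J) → False := by
    intro l hcl
    induction l, hcl using Nat.le_induction with
    | base =>
      intro _ _ hw _
      have := ho.pos _ (hw 0 hc0 (Nat.zero_le _))
      omega
    | succ l hl ih =>
      intro hlt hlx hw hz
      have hpl : p (l + 1) ∈ A J := hw _ (h.p_mem _ (by omega)) le_rfl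
      have hp1 := h.p_lt l (by omega)
      have hp2 := h.p_lt_q l (by omega)
      have hq1 := h.q_lt l (by omega)
      have hit' : Hits (A J) p q l := ⟨_, hpl, hp1, hp2⟩
      have hlx' : ∀ x, l ≤ x → x < t → b ∉ A (X x) := by
        intro x h1 h2
        rcases h1.eq_or_lt with rfl | h1
        · exact hcb _ hl h2 hit'
        · exact hlx x h1 h2
      rcases ho.side hN h ht (by omega) h0 hb hlx' hit' with ⟨h1, h2⟩ | ⟨h1, w, hw1, hw2, hw3⟩
      · exact ih (by omega) hlx' h1 h2
      · obtain ⟨z, hz1, hz2, hz3⟩ := hz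
        refine hN.nc (X l) (X (l + 1)) w (p (l + 1)) (q l) z (by omega) hp2 (by omega) hw1
          (fun hc => hw3 (hw w hc (by omega))) (h.p_mem _ (by omega))
          (h.next_p_notMem (by omega)) (h.q_mem _ (by omega)) (h.q_notMem_next (by omega)) hz1
          (fun hc => hz3 (h1 z hc (by omega)))
  have hix : ∀ x, i ≤ x → x < t → b ∉ A (X x) := fun x h1 h2 => hx x (by omega) h2
  have hqi : q i ∉ A J := by
    intro hq
    have h1 := h.p_lt_q i (by omega)
    have h2 := h.q_lt i (by omega)
    rcases (Nat.succ_le_of_lt hit).eq_or_lt with h3 | h3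
    · subst h3
      exact h.q_notMem_next (by omega) (ho.sub _ h0 hb hq)
    · have := hmax (i + 1) ⟨by omega, h3, _, hq, h1, h2⟩
      omega
  rcases ho.side hN h ht hit h0 hb hix hi with ⟨h1, h2⟩ | ⟨h1, -⟩
  · exact key i (by omega) hit hix h1 h2
  · exact hqi (h1 _ (h.q_mem _ (by omega)) le_rfl)

theorem Chain.last_mem (h : Chain b A r X p q) : b ∈ A (X r) := h.q_last ▸ h.q_mem r le_rfl

theorem Chain.zero_mem (h : Chain b A r X p q) : 0 ∈ A (X 0) := by
  simpa [h.p_zero] using h.p_mem 0 (Nat.zero_le _)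

theorem Chain.exists_first (h : Chain b A r X p q) {y : ℕ} (hy : y ≤ r) (hb : b ∉ A (X y)) :
    ∃ t, y < t ∧ t ≤ r ∧ b ∈ A (X t) ∧ ∀ x, y ≤ x → x < t → b ∉ A (X x) := by
  classical
  have hex : ∃ t, y ≤ t ∧ b ∈ A (X t) := ⟨r, hy, h.last_mem⟩
  have hsp := Nat.find_spec hex
  refine ⟨Nat.find hex, lt_of_le_of_ne hsp.1 ?_, Nat.find_le ⟨hy, h.last_mem⟩, hsp.2, ?_⟩
  · intro he
    exact hb (he ▸ hsp.2)
  · intro x h1 h2 h3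
    exact Nat.find_min hex h2 ⟨h1, h3⟩

theorem Obstructing.zero_notMem (hN : Nodes b A M) (ho : Obstructing b A M J)
    (h : Chain b A r X p q) {y : ℕ} (hyr : y ≤ r) (hy : Hits (A J) p q y) : 0 ∉ A (X y) := by
  intro h0
  have hb : b ∉ A (X y) := fun hb => ho.not_hits h hyr h0 hb hy
  obtain ⟨t, hyt, htr, hbt, hx⟩ := h.exists_first hyr hb
  exact ho.descent hN h htr (h.zero_mem_of_lt hN htr hyt hbt hx h0) hbt h0
    (fun l h1 h2 _ => hx l h1 h2) hy le_rfl hyt hx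

theorem Hits.flip (hN : Nodes b A M) (h : Chain b A r X p q) {y : ℕ} (hyr : y ≤ r)
    {S : Set ℕ} (hy : Hits S p q y) :
    Hits (WSep.flip b S) (fun i => b - q (r - i)) (fun i => b - p (r - i)) (r - y) := by
  obtain ⟨e, he, h1, h2⟩ := hy
  have hq := hN.le _ _ (h.q_mem y hyr)
  refine ⟨b - e, (sub_mem_flip (by omega)).2 he, ?_, ?_⟩ <;>
  · simp only [Nat.sub_sub_self hyr]
    omega

theorem Obstructing.last_notMem (hN : Nodes b A M) (ho : Obstructing b A M J)
    (h : Chain b A r X p q) {y : ℕ} (hyr : y ≤ r) (hy : Hits (A J) p q y) : b ∉ A (X y) := by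
  have := (ho.flip hN).zero_notMem hN.flip (h.flip hN) (Nat.sub_le r y) (hy.flip hN h hyr)
  rwa [zero_mem_flip, Nat.sub_sub_self hyr] at this

theorem Chain.exists_gap (h : Chain b A r X p q) {e : ℕ} (h0 : 0 < e) (hb : e < b) :
    ∃ i ≤ r, p i < e ∧ e < q i := by
  obtain ⟨i, ⟨hir, hi⟩, hmax⟩ := exists_max_of_bdd (P := fun i => i ≤ r ∧ p i < e) r
    ⟨0, Nat.zero_le _, by rwa [h.p_zero]⟩ (fun n hn => hn.1)
  refine ⟨i, hir, hi, ?_⟩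
  rcases hir.eq_or_lt with rfl | hir
  · rwa [h.q_last]
  · have h1 := h.p_lt_q i hir
    by_contra hc
    have := hmax (i + 1) ⟨hir, by omega⟩
    omega

theorem Obstructing.false (hN : Nodes b A M) (ho : Obstructing b A M J)
    (h : Chain b A r X p q) : False := by
  obtain ⟨e, he⟩ := ho.nonempty
  obtain ⟨y, hyr, h1, h2⟩ := h.exists_gap (ho.pos e he).1 (ho.pos e he).2
  have hy : Hits (A J) p q y := ⟨e, he, h1, h2⟩
  have hby := ho.last_notMem hN h hyr hy
  have h0y := ho.zero_notMem hN h hyr hy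
  obtain ⟨t, hyt, htr, hbt, hx⟩ := h.exists_first hyr hby
  by_cases h0t : 0 ∈ A (X t)
  · exact ho.descent hN h htr h0t hbt h.zero_mem
      (fun l _ h2 hl => ho.last_notMem hN h (by omega) hl) hy (Nat.zero_le _) hyt hx
  · obtain ⟨s', hs1, hs2, hs3, hs4⟩ := (h.flip hN).exists_first (Nat.sub_le r y)
      (by rwa [last_mem_flip, Nat.sub_sub_self hyr])
    obtain ⟨s, rfl⟩ : ∃ s, s' = r - s := ⟨r - s', by omega⟩
    have hsr : s ≤ r ∨ r - s = r := by omega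
    obtain ⟨s, hsr, hse⟩ : ∃ u ≤ r, r - s = r - u := ⟨r - (r - s), by omega, by omega⟩
    rw [hse] at hs1 hs2 hs3 hs4
    have hsb := hs3
    rw [last_mem_flip, Nat.sub_sub_self hsr] at hs3
    have hsy : s < y := by omega
    have h0x : ∀ x, s < x → x ≤ y → 0 ∉ A (X x) := by
      intro x hx1 hx2 hx3
      refine hs4 (r - x) (by omega) (by omega) ?_
      rwa [last_mem_flip, Nat.sub_sub_self (by omega)]
    have hbs : b ∈ A (X s) := by
      by_contra hbs
      obtain ⟨t', ht1, ht2, ht3, ht4⟩ := h.exists_first hsr hbs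
      have h0t' := h.zero_mem_of_lt hN ht2 ht1 ht3 ht4 hs3
      rcases le_or_gt t' y with hty | hty
      · exact h0x _ ht1 hty h0t'
      · rcases lt_trichotomy t' t with h' | h' | h'
        · exact hx t' (by omega) h' ht3
        · exact h0t (h' ▸ h0t')
        · exact ht4 t (by omega) h' hbt
    refine (ho.flip hN).descent hN.flip (h.flip hN) (c := 0) (t := r - s) (y := r - y)
      (Nat.sub_le _ _) ?_ hsb (h.flip hN).zero_mem ?_ (hy.flip hN h hyr) (Nat.zero_le _)
      (by omega) hs4
    · rwa [zero_mem_flip, Nat.sub_sub_self hsr]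
    · intro l _ h2 hl
      exact (ho.flip hN).last_notMem hN.flip (h.flip hN) (by omega) hl

theorem Chain.exists_zero_last (hN : Nodes b A M) (h : Chain b A r X p q) :
    ∃ K, 0 ∈ A K ∧ b ∈ A K := by
  by_cases hb : b ∈ A (X 0)
  · exact ⟨_, h.zero_mem, hb⟩
  · obtain ⟨t, h1, h2, h3, h4⟩ := h.exists_first (Nat.zero_le r) hb
    exact ⟨X t, h.zero_mem_of_lt hN h2 h1 h3 h4 h.zero_mem, h3⟩

/-- `(l, u)` is a gap of `A Y`. -/
structure IsGap (A : ι → Set ℕ) (Y : ι) (l u : ℕ) : Prop where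
  left_mem : l ∈ A Y
  right_mem : u ∈ A Y
  notMem : ∀ x, l < x → x < u → x ∉ A Y

theorem exists_isGap (hb : ∀ Y, ∀ x ∈ A Y, x ≤ b) {x : ℕ}
    (h : ∃ Y, x ∉ A Y ∧ (∃ l ∈ A Y, l < x) ∧ ∃ u ∈ A Y, x < u) :
    ∃ Y l u, (IsGap A Y l u ∧ l < x ∧ x < u) ∧
      ∀ Y' l' u', IsGap A Y' l' u' → l' < x → x < u' → u' ≤ u := by
  classical
  obtain ⟨Y, hxY, ⟨l₀, hl, hlx⟩, hu⟩ := h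
  obtain ⟨l, ⟨hl1, hl2⟩, hl3⟩ := exists_max_of_bdd (P := fun l => l < x ∧ l ∈ A Y) x
    ⟨l₀, hlx, hl⟩ (fun n hn => hn.1.le)
  have hu' : ∃ u, u ∈ A Y ∧ x < u := hu
  have hsp := Nat.find_spec hu'
  have hg : IsGap A Y l (Nat.find hu') := by
    refine ⟨hl2, hsp.1, fun z h1 h2 h3 => ?_⟩
    rcases lt_trichotomy z x with h | rfl | h
    · have := hl3 z ⟨h, h3⟩
      omega
    · exact hxY h3
    · exact Nat.find_min hu' h2 ⟨h3, h⟩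
  obtain ⟨u, ⟨Y₁, l₁, h1⟩, hmax⟩ := exists_max_of_bdd
    (P := fun u => ∃ Y l, IsGap A Y l u ∧ l < x ∧ x < u) b ⟨_, Y, l, hg, hl1, hsp.2⟩
    (fun n ⟨Y, l, hn, _⟩ => hb Y _ hn.right_mem)
  exact ⟨Y₁, l₁, u, h1, fun Y' l' u' h2 h3 h4 => hmax u' ⟨Y', l', h2, h3, h4⟩⟩

theorem exists_prechain {E : Set ℕ} (hb : ∀ Y, ∀ x ∈ A Y, x ≤ b)
    (hE : ∀ Y, ∀ x ∈ A Y, x ∈ E ∨ x = 0 ∨ x = b)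
    (hk : ∀ x ∈ E, ∃ Y, x ∉ A Y ∧ (∃ l ∈ A Y, l < x) ∧ ∃ u ∈ A Y, x < u) :
    ∀ d Y l u x, u + d = b → IsGap A Y l u → l < x → x < u →
      (∀ Y' l' u', IsGap A Y' l' u' → l' < x → x < u' → u' ≤ u) →
      ∃ (r : ℕ) (X : ℕ → ι) (p q : ℕ → ℕ), p 0 = l ∧ q 0 = u ∧ q r = b ∧
        (∀ i ≤ r, p i < q i) ∧ (∀ i ≤ r, IsGap A (X i) (p i) (q i)) ∧
        (∀ i < r, p i < p (i + 1) ∧ p (i + 1) < q i ∧ q i < q (i + 1)) := by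
  intro d
  induction d using Nat.strong_induction_on with
  | _ d ih =>
    intro Y l u x hd hg hl hu hmax
    rcases Nat.eq_zero_or_pos d with rfl | hd0
    · exact ⟨0, fun _ => Y, fun _ => l, fun _ => u, rfl, rfl, hd, fun _ _ => hl.trans hu,
        fun _ _ => hg, fun i hi => by omega⟩
    · have huE : u ∈ E := by
        rcases hE Y u hg.right_mem with h | h | h
        exacts [h, by omega, by omega]
      obtain ⟨Y', l', u', ⟨hg', h1, h2⟩, hmax'⟩ := exists_isGap hb (hk u huE)
      have hu'b := hb _ _ hg'.right_mem
      have hll : l < l' := by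
        by_contra hc
        have := hmax Y' l' u' hg' (by omega) (by omega)
        omega
      obtain ⟨r, X, p, q, hp0, hq0, hqr, h3, h4, h5⟩ :=
        ih (b - u') (by omega) Y' l' u' u (by omega) hg' h1 h2 hmax'
      refine ⟨r + 1, fun i => Nat.casesOn i Y X, fun i => Nat.casesOn i l p,
        fun i => Nat.casesOn i u q, rfl, rfl, hqr, ?_, ?_, ?_⟩
      · rintro (_ | i) hi
        · exact hl.trans hu
        · exact h3 i (by omega)
      · rintro (_ | i) hi
        · exact hg
        · exact h4 i (by omega)
      · rintro (_ | i) hi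
        · simp only [hp0, hq0]
          exact ⟨hll, h1, h2⟩
        · exact h5 i (by omega)

theorem exists_chain {E : Set ℕ} (hb : ∀ Y, ∀ x ∈ A Y, x ≤ b)
    (hE : ∀ Y, ∀ x ∈ A Y, x ∈ E ∨ x = 0 ∨ x = b) (hEb : ∀ x ∈ E, x < b) (hne : E.Nonempty)
    (hk : ∀ x ∈ E, ∃ Y, x ∉ A Y ∧ (∃ l ∈ A Y, l < x) ∧ ∃ u ∈ A Y, x < u) :
    ∃ (r : ℕ) (X : ℕ → ι) (p q : ℕ → ℕ), Chain b A r X p q := by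
  classical
  have hsp := Nat.find_spec hne
  obtain ⟨Y, l, u, ⟨hg, hl, hu⟩, hmax⟩ := exists_isGap hb (hk _ hsp)
  have hub := hb _ _ hg.right_mem
  obtain ⟨r, X, p, q, h1, h2, h3, h4, h5, h6⟩ :=
    exists_prechain hb hE hk (b - u) Y l u _ (by omega) hg hl hu hmax
  refine ⟨r, X, p, q, h4, fun i hi => (h5 i hi).left_mem, fun i hi => (h5 i hi).right_mem,
    fun i hi => (h5 i hi).notMem, ?_, h3, fun i hi => (h6 i hi).1, fun i hi => (h6 i hi).2.1,
    fun i hi => (h6 i hi).2.2⟩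
  rw [h1]
  rcases hE Y l hg.left_mem with h | h | h
  · exact absurd h (Nat.find_min hne hl)
  · exact h
  · have := hEb _ hsp
    omega

end WSep

namespace WSep

/-- There is no alternating sequence `w₁ < w₂ < w₃ < w₄` between `J \ K` and `K \ J` that starts
in `J`. -/
def NonCross (J K : Finset ℕ) : Prop :=
  ∀ w₁ w₂ w₃ w₄, w₁ < w₂ → w₂ < w₃ → w₃ < w₄ → w₁ ∈ J → w₁ ∉ K → w₂ ∈ K → w₂ ∉ J →
    w₃ ∈ J → w₃ ∉ K → w₄ ∈ K → w₄ ∉ J → False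

/-- A family of noncrossing sets of equal size containing `insert 0 S` and `insert b S`. -/
structure Base (C : Set (Finset ℕ)) (b : ℕ) (S : Finset ℕ) : Prop where
  card : ∀ J ∈ C, #J = #S + 1
  nc : ∀ J ∈ C, ∀ K ∈ C, NonCross J K
  pos : 0 < b
  zero_notMem : 0 ∉ S
  last_notMem : b ∉ S
  zero_mem : insert 0 S ∈ C
  last_mem : insert b S ∈ C

variable {C : Set (Finset ℕ)} {b : ℕ} {S : Finset ℕ}

theorem Base.card_sdiff (B : Base C b S) {J : Finset ℕ} (hJ : J ∈ C) : #(J \ S) = #(S \ J) + 1 := by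
  have h1 := B.card J hJ
  have h2 := card_sdiff_add_card_inter J S
  have h3 := card_sdiff_add_card_inter S J
  rw [inter_comm] at h3
  omega

/-- Noncrossing with `insert e S`, with an alternation starting outside `S`. -/
theorem Base.alt (B : Base C b S) {J : Finset ℕ} (hJ : J ∈ C) (e : ℕ) (he : e = 0 ∨ e = b)
    (w₁ w₂ w₃ w₄ : ℕ) (h₁ : w₁ < w₂) (h₂ : w₂ < w₃) (h₃ : w₃ < w₄) (a₁ : w₁ ∈ J) (b₁ : w₁ ∉ S)
    (a₂ : w₂ ∈ S ∨ w₂ = e) (b₂ : w₂ ∉ J) (a₃ : w₃ ∈ J) (b₃ : w₃ ∉ S) (a₄ : w₄ ∈ S ∨ w₄ = e)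
    (b₄ : w₄ ∉ J) (c₁ : w₁ ≠ e) (c₃ : w₃ ≠ e) : False := by
  have hm : insert e S ∈ C := by
    rcases he with rfl | rfl
    exacts [B.zero_mem, B.last_mem]
  refine B.nc J hJ _ hm w₁ w₂ w₃ w₄ h₁ h₂ h₃ a₁ ?_ ?_ b₂ a₃ ?_ ?_ b₄ <;> grind

/-- Noncrossing with `insert e S`, with an alternation starting in `S`. -/
theorem Base.alt' (B : Base C b S) {J : Finset ℕ} (hJ : J ∈ C) (e : ℕ) (he : e = 0 ∨ e = b)
    (w₁ w₂ w₃ w₄ : ℕ) (h₁ : w₁ < w₂) (h₂ : w₂ < w₃) (h₃ : w₃ < w₄) (a₁ : w₁ ∈ S ∨ w₁ = e)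
    (b₁ : w₁ ∉ J) (a₂ : w₂ ∈ J) (b₂ : w₂ ∉ S) (a₃ : w₃ ∈ S ∨ w₃ = e) (b₃ : w₃ ∉ J)
    (a₄ : w₄ ∈ J) (b₄ : w₄ ∉ S) (c₂ : w₂ ≠ e) (c₄ : w₄ ≠ e) : False := by
  have hm : insert e S ∈ C := by
    rcases he with rfl | rfl
    exacts [B.zero_mem, B.last_mem]
  refine B.nc _ hm J hJ w₁ w₂ w₃ w₄ h₁ h₂ h₃ ?_ b₁ a₂ ?_ ?_ b₃ a₄ ?_ <;> grind

theorem Base.straddle (B : Base C b S) {J : Finset ℕ} (hJ : J ∈ C) (h0 : 0 ∈ J) (hb : b ∈ J)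
    {μ ν : ℕ} (hμ : μ ∈ S) (hμJ : μ ∉ J) (hμb : μ < b) (hν : ν ∈ S) (hνJ : ν ∉ J)
    (hνb : b < ν) : False := by
  have hc := B.card_sdiff hJ
  have h2 : #({μ, ν} : Finset ℕ) ≤ #(S \ J) := card_le_card (by grind)
  rw [card_pair (by omega)] at h2
  obtain ⟨p, hp, hp'⟩ := exists_mem_notMem_of_card_lt_card (s := {0, b}) (t := J \ S)
    (by have := card_le_two (a := 0) (b := b); omega)
  have := B.zero_notMem
  have := B.last_notMem
  have := B.pos
  simp only [mem_sdiff, mem_insert, mem_singleton, not_or] at hp hp'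
  have hpμ : p ≠ μ := by grind
  have hpν : p ≠ ν := by grind
  rcases lt_or_gt_of_ne hp'.2 with h | h
  · rcases lt_or_gt_of_ne hpμ with h' | h'
    · exact B.alt hJ 0 (.inl rfl) p μ b ν h' hμb hνb hp.1 hp.2 (.inl hμ) hμJ hb (by grind)
        (.inl hν) hνJ (by omega) (by omega)
    · exact B.alt hJ b (.inr rfl) 0 μ p ν (by grind) h' (by omega) h0 (by grind) (.inl hμ) hμJ
        hp.1 hp.2 (.inl hν) hνJ (by omega) (by omega)
  · rcases lt_or_gt_of_ne hpν with h' | h'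
    · exact B.alt hJ b (.inr rfl) 0 μ p ν (by grind) (by omega) (by omega) h0 (by grind)
        (.inl hμ) hμJ hp.1 hp.2 (.inl hν) hνJ (by omega) (by omega)
    · exact B.alt' hJ 0 (.inl rfl) μ b ν p hμb hνb h' (.inl hμ) hμJ hb (by grind)
        (.inl hν) hνJ hp.1 hp.2 (by omega) (by omega)

/-- The nodes attached to the members `J` of `C`: the part of `J \ S` in `[0, b]`, cut at an
element `μ < b` of `S \ J` when `J` contains both `0` and `b`. -/
inductive Node (C : Set (Finset ℕ)) (b : ℕ) (S : Finset ℕ) : Type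
  | whole (J : Finset ℕ) (hJ : J ∈ C) (h : 0 ∈ J → b ∈ J → ∀ μ ∈ S, μ ∉ J → b < μ)
  | left (J : Finset ℕ) (μ : ℕ) (hJ : J ∈ C) (h0 : 0 ∈ J) (hb : b ∈ J) (hμ : μ ∈ S)
      (hμJ : μ ∉ J) (hμb : μ < b)
  | right (J : Finset ℕ) (μ : ℕ) (hJ : J ∈ C) (h0 : 0 ∈ J) (hb : b ∈ J) (hμ : μ ∈ S)
      (hμJ : μ ∉ J) (hμb : μ < b)

/-- The carrier of a node. -/
def Node.carrier : Node C b S → Set ℕ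
  | .whole J _ _ => {x | x ∈ J ∧ x ∉ S ∧ x ≤ b}
  | .left J μ _ _ _ _ _ _ => {x | x ∈ J ∧ x ∉ S ∧ x < μ}
  | .right J μ _ _ _ _ _ _ => {x | x ∈ J ∧ x ∉ S ∧ μ < x ∧ x ≤ b}

/-- The label of a node. -/
def Node.label : Node C b S → Set ℕ
  | .whole J _ _ => {x | x ∈ S ∧ x ∉ J ∧ b < x}
  | .left _ _ _ _ _ _ _ _ => ∅
  | .right _ _ _ _ _ _ _ _ => ∅

theorem Base.nodes_nc (B : Base C b S) (X Y : Node C b S) (w₁ w₂ w₃ w₄ : ℕ) (h₁ : w₁ < w₂)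
    (h₂ : w₂ < w₃) (h₃ : w₃ < w₄) (a₁ : w₁ ∈ X.carrier) (b₁ : w₁ ∉ Y.carrier)
    (a₂ : w₂ ∈ Y.carrier) (b₂ : w₂ ∉ X.carrier) (a₃ : w₃ ∈ X.carrier) (b₃ : w₃ ∉ Y.carrier)
    (a₄ : w₄ ∈ Y.carrier) (b₄ : w₄ ∉ X.carrier) : False := by
  have h0S := B.zero_notMem
  have hbS := B.last_notMem
  cases X with
  | whole J hJ h =>
    cases Y with
    | whole K hK h' =>
      simp only [Node.carrier, Set.mem_ofPred_eq] at *
      have := B.nc J hJ K hK w₁ w₂ w₃ w₄ h₁ h₂ h₃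
      grind
    | left K μ hK h0 hb hμ hμK hμb =>
      simp only [Node.carrier, Set.mem_ofPred_eq] at *
      have := B.nc J hJ K hK w₁ w₂ w₃ w₄ h₁ h₂ h₃
      grind
    | right K μ hK h0 hb hμ hμK hμb =>
      simp only [Node.carrier, Set.mem_ofPred_eq] at *
      have := B.nc J hJ K hK w₁ w₂ w₃ w₄ h₁ h₂ h₃
      have := B.nc J hJ K hK μ w₂ w₃ w₄
      have := fun x y => h x y μ hμ
      have := B.alt' hJ 0 (.inl rfl) 0 w₁ μ w₃
      have := B.alt hJ b (.inr rfl) w₁ μ w₃ b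
      by_cases 0 ∈ J <;> by_cases b ∈ J <;> grind
  | left J μ hJ h0 hb hμ hμJ hμb =>
    cases Y with
    | whole K hK h' =>
      simp only [Node.carrier, Set.mem_ofPred_eq] at *
      have := B.nc J hJ K hK w₁ w₂ w₃ w₄ h₁ h₂ h₃
      have := B.nc J hJ K hK w₁ w₂ w₃ μ
      have := fun x y => h' x y μ hμ
      have := B.alt' hK 0 (.inl rfl) 0 w₂ μ w₄
      have := B.alt hK b (.inr rfl) w₂ μ w₄ b
      by_cases 0 ∈ K <;> by_cases b ∈ K <;> grind
    | left K ν hK h0' hb' hν hνK hνb =>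
      simp only [Node.carrier, Set.mem_ofPred_eq] at *
      have := B.nc J hJ K hK w₁ w₂ w₃ w₄ h₁ h₂ h₃
      have := B.nc J hJ K hK w₁ w₂ w₃ μ
      have := B.alt hK 0 (.inl rfl) w₂ μ w₄ ν
      grind
    | right K ν hK h0' hb' hν hνK hνb =>
      simp only [Node.carrier, Set.mem_ofPred_eq] at *
      have := B.nc J hJ K hK ν w₂ w₃ μ
      have := B.alt' hJ 0 (.inl rfl) ν w₃ μ b
      have := B.alt' hK 0 (.inl rfl) ν w₂ μ b
      by_cases μ ∈ K <;> by_cases ν ∈ J <;> grind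
  | right J μ hJ h0 hb hμ hμJ hμb =>
    cases Y with
    | whole K hK h' =>
      simp only [Node.carrier, Set.mem_ofPred_eq] at *
      have := B.nc J hJ K hK w₁ w₂ w₃ w₄ h₁ h₂ h₃
      grind
    | left K ν hK h0' hb' hν hνK hνb =>
      simp only [Node.carrier, Set.mem_ofPred_eq] at *
      have := B.nc J hJ K hK w₁ w₂ w₃ w₄ h₁ h₂ h₃
      grind
    | right K ν hK h0' hb' hν hνK hνb =>
      simp only [Node.carrier, Set.mem_ofPred_eq] at *
      have := B.nc J hJ K hK w₁ w₂ w₃ w₄ h₁ h₂ h₃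
      have := B.nc J hJ K hK ν w₂ w₃ w₄
      have := B.alt' hJ 0 (.inl rfl) μ w₁ ν w₃
      grind

theorem Base.nodes_split (B : Base C b S) (X Y : Node C b S) (u v z : ℕ) (h₁ : u < v) (h₂ : v < z)
    (a₁ : u ∈ Y.carrier) (b₁ : u ∉ X.carrier) (a₂ : v ∈ X.carrier) (b₂ : v ∉ Y.carrier)
    (a₃ : z ∈ Y.carrier) (b₃ : z ∉ X.carrier) : Y.label ⊆ X.label := by
  have h0S := B.zero_notMem
  have hbS := B.last_notMem
  cases Y with
  | left => simp [Node.label]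
  | right => simp [Node.label]
  | whole K hK h =>
    intro ν hν
    cases X with
    | whole J hJ h' =>
      simp only [Node.carrier, Node.label, Set.mem_ofPred_eq] at *
      have := B.nc K hK J hJ u v z ν
      grind
    | left J μ hJ h0 hb hμ hμJ hμb =>
      exfalso
      simp only [Node.carrier, Node.label, Set.mem_ofPred_eq] at *
      have h3 := B.alt hJ 0 (.inl rfl) v μ b ν
      have hνJ : ν ∈ J := by grind
      have := B.nc K hK J hJ u v z ν
      have := B.nc K hK J hJ u v μ ν
      have := fun x y => h x y μ hμ
      have := B.alt' hK 0 (.inl rfl) 0 u μ z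
      have := B.alt hK b (.inr rfl) u μ z b
      by_cases 0 ∈ K <;> by_cases b ∈ K <;> grind
    | right J μ hJ h0 hb hμ hμJ hμb =>
      exfalso
      simp only [Node.carrier, Node.label, Set.mem_ofPred_eq] at *
      have h3 := B.alt hJ b (.inr rfl) 0 μ v ν
      have hνJ : ν ∈ J := by grind
      have := B.nc K hK J hJ u v z ν
      have := B.nc K hK J hJ μ v z ν
      have := fun x y => h x y μ hμ
      have := B.alt' hK 0 (.inl rfl) 0 u μ z
      have := B.alt hK b (.inr rfl) u μ z b
      by_cases 0 ∈ K <;> by_cases b ∈ K <;> grind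

theorem Node.carrier_le (X : Node C b S) : ∀ x ∈ X.carrier, x ≤ b := by
  cases X <;> simp only [Node.carrier, Set.mem_ofPred_eq] <;> grind

theorem Base.nodes (B : Base C b S) : Nodes b (Node.carrier (C := C) (b := b) (S := S))
    Node.label where
  le := Node.carrier_le
  nc := B.nodes_nc
  split := B.nodes_split

theorem Node.exists_whole (X : Node C b S) (h0 : 0 ∈ X.carrier) (hb : b ∈ X.carrier) :
    ∃ J hJ h, X = .whole J hJ h := by
  cases X with
  | whole J hJ h => exact ⟨J, hJ, h, rfl⟩
  | left =>
    simp only [Node.carrier, Set.mem_ofPred_eq] at h0 hb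
    omega
  | right =>
    simp only [Node.carrier, Set.mem_ofPred_eq] at h0 hb
    omega

theorem Node.exists_whole_of_label {X : Node C b S} {ν : ℕ} (h : ν ∈ X.label) :
    ∃ J hJ h', X = .whole J hJ h' := by
  cases X with
  | whole J hJ h' => exact ⟨J, hJ, h', rfl⟩
  | left => simp [Node.label] at h
  | right => simp [Node.label] at h

/-- A set of `C` that crosses `insert x S` provides a separating quadruple. -/
theorem Base.separates (B : Base C b S) {J : Finset ℕ} (hJ : J ∈ C) {x : ℕ} (hx : x ∉ S)
    (h : ¬ (NonCross (insert x S) J ∧ NonCross J (insert x S))) :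
    (x ∉ J ∧ ∃ p₁ p₂ μ, p₁ ∈ J ∧ p₁ ∉ S ∧ p₂ ∈ J ∧ p₂ ∉ S ∧ μ ∈ S ∧ μ ∉ J ∧
      ((p₁ < x ∧ x < p₂ ∧ p₂ < μ) ∨ (μ < p₁ ∧ p₁ < x ∧ x < p₂) ∨ (x < p₁ ∧ p₁ < μ ∧ μ < p₂) ∨
        (p₁ < μ ∧ μ < p₂ ∧ p₂ < x))) := by
  have hpos := B.pos
  by_contra hc
  refine h ⟨?_, ?_⟩
  · intro w₁ w₂ w₃ w₄ h₁ h₂ h₃ a₁ b₁ a₂ b₂ a₃ b₃ a₄ b₄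
    rw [mem_insert] at a₁ a₃ b₂ b₄
    push Not at b₂ b₄
    rcases a₁ with rfl | a₁ <;> rcases a₃ with rfl | a₃
    · omega
    · exact hc ⟨b₁, w₂, w₄, w₃, a₂, b₂.2, a₄, b₄.2, a₃, b₃, by omega⟩
    · exact hc ⟨b₃, w₂, w₄, w₁, a₂, b₂.2, a₄, b₄.2, a₁, b₁, by omega⟩
    · exact B.alt' hJ 0 (.inl rfl) w₁ w₂ w₃ w₄ h₁ h₂ h₃ (.inl a₁) b₁ a₂ b₂.2 (.inl a₃) b₃
        a₄ b₄.2 (by omega) (by omega)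
  · intro w₁ w₂ w₃ w₄ h₁ h₂ h₃ a₁ b₁ a₂ b₂ a₃ b₃ a₄ b₄
    rw [mem_insert] at a₂ a₄ b₁ b₃
    push Not at b₁ b₃
    rcases a₂ with rfl | a₂ <;> rcases a₄ with rfl | a₄
    · omega
    · exact hc ⟨b₂, w₁, w₃, w₄, a₁, b₁.2, a₃, b₃.2, a₄, b₄, by omega⟩
    · exact hc ⟨b₄, w₁, w₃, w₂, a₁, b₁.2, a₃, b₃.2, a₂, b₂, by omega⟩
    · have e1 := B.alt hJ 0 (.inl rfl) w₁ w₂ w₃ w₄ h₁ h₂ h₃ a₁ b₁.2 (.inl a₂) b₂ a₃ b₃.2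
        (.inl a₄) b₄
      have e2 := B.alt hJ b (.inr rfl) w₁ w₂ w₃ w₄ h₁ h₂ h₃ a₁ b₁.2 (.inl a₂) b₂ a₃ b₃.2
        (.inl a₄) b₄
      have h1 : w₁ = 0 := by by_contra; exact e1 (by grind) (by grind)
      have h3 : w₃ = b := by by_contra; exact e2 (by grind) (by grind)
      subst h1
      subst h3
      exact B.straddle hJ a₁ a₃ a₂ b₂ h₂ a₄ b₄ h₃

theorem Base.exists_node (B : Base C b S) {x : ℕ} (hx : x ∉ S) (h0x : 0 < x) (hxb : x < b)
    {J : Finset ℕ} (hJ : J ∈ C) (h : ¬ (NonCross (insert x S) J ∧ NonCross J (insert x S))) :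
    ∃ Y : Node C b S, x ∉ Y.carrier ∧ (∃ l ∈ Y.carrier, l < x) ∧ ∃ u ∈ Y.carrier, x < u := by
  have h0S := B.zero_notMem
  have hbS := B.last_notMem
  obtain ⟨hxJ, p₁, p₂, μ, hp₁, hp₁S, hp₂, hp₂S, hμ, hμJ, hpat⟩ := B.separates hJ hx h
  by_cases hQ : 0 ∈ J ∧ b ∈ J ∧ ∃ ν ∈ S, ν ∉ J ∧ ν < b
  · obtain ⟨h0, hb, ν, hν, hνJ, hνb⟩ := hQ
    have hμb : μ < b := by
      rcases lt_trichotomy μ b with h | rfl | h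
      · exact h
      · exact absurd hμ hbS
      · exact (B.straddle hJ h0 hb hν hνJ hνb hμ hμJ h).elim
    rcases lt_or_gt_of_ne (show x ≠ μ by grind) with hxμ | hxμ
    · refine ⟨.left J μ hJ h0 hb hμ hμJ hμb, ?_, ⟨0, ?_, h0x⟩, ?_⟩
      · simp [Node.carrier, hxJ]
      · simp only [Node.carrier, Set.mem_ofPred_eq]
        exact ⟨h0, h0S, by omega⟩
      · simp only [Node.carrier, Set.mem_ofPred_eq]
        rcases hpat with h | h | h | h
        · exact ⟨p₂, ⟨hp₂, hp₂S, by omega⟩, by omega⟩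
        · omega
        · exact ⟨p₁, ⟨hp₁, hp₁S, by omega⟩, by omega⟩
        · omega
    · refine ⟨.right J μ hJ h0 hb hμ hμJ hμb, ?_, ?_, ⟨b, ?_, hxb⟩⟩
      · simp [Node.carrier, hxJ]
      · simp only [Node.carrier, Set.mem_ofPred_eq]
        rcases hpat with h | h | h | h
        · omega
        · exact ⟨p₁, ⟨hp₁, hp₁S, by omega⟩, by omega⟩
        · omega
        · exact ⟨p₂, ⟨hp₂, hp₂S, by omega⟩, by omega⟩
      · simp only [Node.carrier, Set.mem_ofPred_eq]
        exact ⟨hb, hbS, by omega⟩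
  · refine ⟨.whole J hJ fun h0 hb ν hν hνJ => ?_, ?_, ?_, ?_⟩
    · by_contra hc
      exact hQ ⟨h0, hb, ν, hν, hνJ, lt_of_le_of_ne (by omega) (by grind)⟩
    · simp [Node.carrier, hxJ]
    · simp only [Node.carrier, Set.mem_ofPred_eq]
      rcases hpat with h | h | h | h
      · exact ⟨p₁, ⟨hp₁, hp₁S, by omega⟩, by omega⟩
      · exact ⟨p₁, ⟨hp₁, hp₁S, by omega⟩, by omega⟩
      · refine ⟨0, ⟨?_, h0S, by omega⟩, h0x⟩
        by_contra h0
        exact B.alt' hJ 0 (.inl rfl) 0 p₁ μ p₂ (by omega) h.2.1 h.2.2 (.inr rfl) h0 hp₁ hp₁S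
          (.inl hμ) hμJ hp₂ hp₂S (by omega) (by omega)
      · exact ⟨p₁, ⟨hp₁, hp₁S, by omega⟩, by omega⟩
    · simp only [Node.carrier, Set.mem_ofPred_eq]
      by_cases hb : b ∈ J
      · exact ⟨b, ⟨hb, hbS, le_rfl⟩, hxb⟩
      have hp₁b : p₁ ≠ b := by grind
      have hp₂b : p₂ ≠ b := by grind
      rcases hpat with h | h | h | h
      · rcases lt_or_gt_of_ne hp₂b with h' | h'
        · exact ⟨p₂, ⟨hp₂, hp₂S, by omega⟩, by omega⟩
        · exact (B.alt hJ b (.inr rfl) p₁ b p₂ μ (by omega) h' h.2.2 hp₁ hp₁S (.inr rfl) hb hp₂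
            hp₂S (.inl hμ) hμJ hp₁b hp₂b).elim
      · rcases lt_or_gt_of_ne hp₂b with h' | h'
        · exact ⟨p₂, ⟨hp₂, hp₂S, by omega⟩, by omega⟩
        · exact (B.alt' hJ b (.inr rfl) μ p₁ b p₂ h.1 (by omega) h' (.inl hμ) hμJ hp₁ hp₁S
            (.inr rfl) hb hp₂ hp₂S hp₁b hp₂b).elim
      · rcases lt_or_gt_of_ne hp₁b with h' | h'
        · exact ⟨p₁, ⟨hp₁, hp₁S, by omega⟩, by omega⟩
        · exact (B.alt' hJ b (.inr rfl) b p₁ μ p₂ h' h.2.1 h.2.2 (.inr rfl) hb hp₁ hp₁S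
            (.inl hμ) hμJ hp₂ hp₂S hp₁b hp₂b).elim
      · exact (B.alt hJ b (.inr rfl) p₁ μ p₂ b h.1 h.2.1 (by omega) hp₁ hp₁S (.inl hμ) hμJ hp₂
          hp₂S (.inr rfl) hb hp₁b hp₂b).elim

/-- The members of `C` lying over the interval `(0, b)`. -/
def Inner (C : Set (Finset ℕ)) (b : ℕ) (S : Finset ℕ) : Set (Finset ℕ) :=
  {J | J ∈ C ∧ 0 ∉ J ∧ b ∉ J ∧ ∀ x ∈ J, x ∉ S → x < b}

/-- The members of `C` containing `0` and `b` that lie over the complementary interval. -/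
def Outer (C : Set (Finset ℕ)) (b : ℕ) (S : Finset ℕ) : Set (Finset ℕ) :=
  {K | K ∈ C ∧ 0 ∈ K ∧ b ∈ K ∧ ∀ x ∈ S, x ∉ K → b < x}

theorem Base.obstructing (B : Base C b S) {J : Finset ℕ} (hJ : J ∈ Inner C b S)
    (hK : ∀ K ∈ Outer C b S, J \ S ⊆ K) :
    Obstructing b (Node.carrier (C := C) (b := b) (S := S)) Node.label
      (.whole J hJ.1 fun h0 => absurd h0 hJ.2.1) := by
  obtain ⟨hJC, hJ0, hJb, hJlt⟩ := hJ
  have h0S := B.zero_notMem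
  have hbS := B.last_notMem
  have hpos := B.pos
  have hout : ∀ K : Node C b S, 0 ∈ K.carrier → b ∈ K.carrier →
      ∃ L ∈ Outer C b S, K.carrier = {x | x ∈ L ∧ x ∉ S ∧ x ≤ b} ∧
        K.label = {x | x ∈ S ∧ x ∉ L ∧ b < x} := by
    intro K h0 hb
    obtain ⟨L, hL, h, rfl⟩ := K.exists_whole h0 hb
    exact ⟨L, ⟨hL, h0.1, hb.1, h h0.1 hb.1⟩, rfl, rfl⟩
  constructor
  · have := B.card_sdiff hJC
    obtain ⟨e, he⟩ : (J \ S).Nonempty := by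
      rw [← card_pos]
      omega
    rw [mem_sdiff] at he
    exact ⟨e, he.1, he.2, (hJlt e he.1 he.2).le⟩
  · rintro e ⟨h1, h2, -⟩
    exact ⟨Nat.pos_of_ne_zero (by grind), hJlt e h1 h2⟩
  · rintro K h0 hb e ⟨h1, h2, h3⟩
    obtain ⟨L, hL, h, -⟩ := hout K h0 hb
    rw [h]
    exact ⟨hK L hL (by simp [h1, h2]), h2, h3⟩
  · intro K Y h0 hb hY hYJ hKY
    obtain ⟨L, hL, -, hlab⟩ := hout K h0 hb
    rw [hlab] at hKY
    have hPL : insert 0 (insert b (J \ S)) ⊆ L \ S := by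
      intro y hy
      simp only [mem_insert, mem_sdiff] at hy ⊢
      rcases hy with rfl | rfl | hy
      exacts [⟨hL.2.1, h0S⟩, ⟨hL.2.2.1, hbS⟩, ⟨hK L hL (by simp [hy]), hy.2⟩]
    have hcard := card_le_card hPL
    rw [card_insert_of_notMem (by grind), card_insert_of_notMem (by grind),
      B.card_sdiff hL.1] at hcard
    obtain ⟨ν, hν⟩ : (S \ L).Nonempty := by
      rw [← card_pos]
      omega
    rw [mem_sdiff] at hν
    have hνb := hL.2.2.2 ν hν.1 hν.2
    obtain ⟨T, hT, h, rfl⟩ := Node.exists_whole_of_label (hKY ⟨hν.1, hν.2, hνb⟩)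
    have hνT : ν ∉ T := (hKY ⟨hν.1, hν.2, hνb⟩).2.1
    obtain ⟨e, he⟩ := hY
    have heJ := hYJ he
    simp only [Node.carrier, Node.label, Set.mem_ofPred_eq, Set.subset_def] at hYJ hKY he heJ
    have heb := hJlt e heJ.1 heJ.2.1
    have he0 : 0 < e := Nat.pos_of_ne_zero (by grind)
    have h0T : 0 ∉ T := fun hc => hJ0 (hYJ 0 ⟨hc, h0S, by omega⟩).1
    have hbT : b ∉ T := fun hc => hJb (hYJ b ⟨hc, hbS, le_rfl⟩).1
    have hTJ : T \ S ⊆ J \ S := by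
      intro y hy
      rw [mem_sdiff] at hy ⊢
      refine ⟨?_, hy.2⟩
      rcases le_or_gt y b with hyb | hyb
      · exact (hYJ y ⟨hy.1, hy.2, hyb⟩).1
      · exfalso
        rcases lt_or_gt_of_ne (show y ≠ ν by grind) with h' | h'
        · exact B.alt hT b (.inr rfl) e b y ν heb hyb h' he.1 he.2.1 (.inr rfl) hbT hy.1 hy.2
            (.inl hν.1) hνT (by omega) (by omega)
        · exact B.alt' hT 0 (.inl rfl) 0 e ν y he0 (by omega) h' (.inr rfl) h0T he.1 he.2.1
            (.inl hν.1) hνT hy.1 hy.2 (by omega) (by omega)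
    have h1 := card_le_card hTJ
    have h2 : #(S \ L) ≤ #(S \ T) := by
      refine card_le_card fun y hy => ?_
      rw [mem_sdiff] at hy ⊢
      exact ⟨hy.1, (hKY y ⟨hy.1, hy.2, hL.2.2.2 y hy.1 hy.2⟩).2.1⟩
    have h3 := B.card_sdiff hT
    omega

/-- If no element of the interval `(0, b)` can be inserted into `S`, then `C` has outer members
and no inner member is contained in all of them. -/
theorem Base.outer_of_blocked (B : Base C b S) (hE : ∃ x, 0 < x ∧ x < b ∧ x ∉ S)
    (hk : ∀ x, 0 < x → x < b → x ∉ S →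
      ∃ J ∈ C, ¬ (NonCross (insert x S) J ∧ NonCross J (insert x S))) :
    (∃ K, K ∈ Outer C b S) ∧ ∀ J ∈ Inner C b S, ∃ K ∈ Outer C b S, ¬ J \ S ⊆ K := by
  obtain ⟨r, X, p, q, hch⟩ := exists_chain (A := Node.carrier (C := C) (b := b) (S := S))
    (E := {x | 0 < x ∧ x < b ∧ x ∉ S}) Node.carrier_le (fun Y x hx => by
      have h1 := Node.carrier_le Y x hx
      have h2 : x ∉ S := by
        cases Y <;> simp only [Node.carrier, Set.mem_ofPred_eq] at hx <;> exact hx.2.1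
      simp only [Set.mem_ofPred_eq]
      grind) (fun x hx => hx.2.1) hE (fun x hx => by
      obtain ⟨J, hJ, h⟩ := hk x hx.1 hx.2.1 hx.2.2
      exact B.exists_node hx.2.2 hx.1 hx.2.1 hJ h)
  constructor
  · obtain ⟨K, h0, hb⟩ := hch.exists_zero_last B.nodes
    obtain ⟨L, hL, h, rfl⟩ := K.exists_whole h0 hb
    exact ⟨L, hL, h0.1, hb.1, h h0.1 hb.1⟩
  · intro J hJ
    by_contra! hc
    exact (B.obstructing hJ hc).false B.nodes hch

end WSep

namespace WSep

variable {C : Set (Finset ℕ)} {b : ℕ} {S : Finset ℕ}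

/-- The cyclic shift of `[0, c + d)` taking `c` to `0`. -/
def rot (c d w : ℕ) : ℕ := if w < c then w + d else w - c

theorem rot_lt {c d w : ℕ} (h : w < c + d) : rot c d w < c + d := by
  unfold rot
  split <;> omega

theorem rot_rot {c d w : ℕ} (h : w < c + d) : rot d c (rot c d w) = w := by
  unfold rot
  split <;> split <;> omega

/-- Complementing and rotating preserves noncrossing pairs. -/
theorem NonCross.of_rot {c d : ℕ} {J K J' K' : Finset ℕ} (hJ : J ⊆ range (c + d))
    (hK : K ⊆ range (c + d)) (h1 : ∀ w < c + d, (w ∈ J ↔ rot c d w ∉ J'))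
    (h2 : ∀ w < c + d, (w ∈ K ↔ rot c d w ∉ K')) (n1 : NonCross J' K') (n2 : NonCross K' J') :
    NonCross J K := by
  intro w₁ w₂ w₃ w₄ l₁ l₂ l₃ a₁ b₁ a₂ b₂ a₃ b₃ a₄ b₄
  have e₁ := mem_range.1 (hJ a₁)
  have e₂ := mem_range.1 (hK a₂)
  have e₃ := mem_range.1 (hJ a₃)
  have e₄ := mem_range.1 (hK a₄)
  rw [h1 _ ‹_›] at a₁ a₃ b₂ b₄
  rw [h2 _ ‹_›] at a₂ a₄ b₁ b₃
  rw [not_not] at b₁ b₂ b₃ b₄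
  rcases lt_or_ge w₁ c with g₁ | g₁ <;> rcases lt_or_ge w₂ c with g₂ | g₂ <;>
    rcases lt_or_ge w₃ c with g₃ | g₃ <;> rcases lt_or_ge w₄ c with g₄ | g₄ <;> try omega
  · refine n2 _ _ _ _ ?_ ?_ ?_ b₁ a₁ b₂ a₂ b₃ a₃ b₄ a₄ <;> unfold rot <;> grind
  · refine n1 _ _ _ _ ?_ ?_ ?_ b₄ a₄ b₁ a₁ b₂ a₂ b₃ a₃ <;> unfold rot <;> grind
  · refine n2 _ _ _ _ ?_ ?_ ?_ b₃ a₃ b₄ a₄ b₁ a₁ b₂ a₂ <;> unfold rot <;> grind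
  · refine n1 _ _ _ _ ?_ ?_ ?_ b₂ a₂ b₃ a₃ b₄ a₄ b₁ a₁ <;> unfold rot <;> grind
  · refine n2 _ _ _ _ ?_ ?_ ?_ b₁ a₁ b₂ a₂ b₃ a₃ b₄ a₄ <;> unfold rot <;> grind

/-- The rotated complement of `J` in `[0, c + d)`. -/
def rotCompl (c d : ℕ) (J : Finset ℕ) : Finset ℕ := {z ∈ range (c + d) | rot c d z ∉ J}

theorem mem_rotCompl {c d z : ℕ} {J : Finset ℕ} :
    z ∈ rotCompl c d J ↔ z < c + d ∧ rot c d z ∉ J := by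
  simp [rotCompl]

theorem rotCompl_subset {c d : ℕ} {J : Finset ℕ} : rotCompl c d J ⊆ range (c + d) :=
  filter_subset _ _

theorem card_rotCompl {c d : ℕ} {J : Finset ℕ} (hJ : J ⊆ range (c + d)) :
    #(rotCompl c d J) + #J = c + d := by
  have h : #(rotCompl c d J) = #(range (c + d) \ J) := by
    refine card_nbij' (rot c d) (rot d c) ?_ ?_ ?_ ?_
    · intro z hz
      simp only [mem_coe, mem_rotCompl, mem_sdiff, mem_range] at hz ⊢
      exact ⟨rot_lt hz.1, hz.2⟩
    · intro z hz
      simp only [mem_coe, mem_rotCompl, mem_sdiff, mem_range] at hz ⊢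
      have h : z < d + c := by omega
      rw [rot_rot h]
      exact ⟨by have := rot_lt h; omega, hz.2⟩
    · intro z hz
      simp only [mem_coe, mem_rotCompl] at hz
      exact rot_rot hz.1
    · intro z hz
      simp only [mem_coe, mem_sdiff, mem_range] at hz
      exact rot_rot (by omega)
  rw [h, card_sdiff_add_card_eq_card hJ, card_range]

theorem NonCross.to_rotCompl {c d : ℕ} {J K : Finset ℕ} (n1 : NonCross J K) (n2 : NonCross K J) :
    NonCross (rotCompl c d J) (rotCompl c d K) :=
  NonCross.of_rot rotCompl_subset rotCompl_subset (by simp +contextual [mem_rotCompl])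
    (by simp +contextual [mem_rotCompl]) n1 n2

theorem NonCross.of_rotCompl {c d : ℕ} {J K : Finset ℕ} (hJ : J ⊆ range (c + d))
    (hK : K ⊆ range (c + d)) (n1 : NonCross (rotCompl c d J) (rotCompl c d K))
    (n2 : NonCross (rotCompl c d K) (rotCompl c d J)) : NonCross J K := by
  rw [add_comm] at hJ hK
  refine NonCross.of_rot hJ hK (fun w hw => ?_) (fun w hw => ?_) n1 n2 <;>
    rw [mem_rotCompl, rot_rot hw, add_comm c d] <;> have := rot_lt hw <;> tauto

/-- If no element of `S` beyond `b` can be removed from `S ∪ {0, b}`, then `C` has inner members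
and every outer member misses some element of `S` that an inner member contains. -/
theorem Base.inner_of_blocked (B : Base C b S) {N : ℕ} (hN : ∀ J ∈ C, J ⊆ range N)
    (hE : ∃ y ∈ S, b < y) (hk : ∀ y ∈ S, b < y → ∃ J ∈ C,
      ¬ (NonCross ((insert 0 (insert b S)).erase y) J ∧
        NonCross J ((insert 0 (insert b S)).erase y))) :
    (∃ J, J ∈ Inner C b S) ∧ ∀ K ∈ Outer C b S, ∃ J ∈ Inner C b S, ∃ y ∈ S, y ∉ K ∧ y ∈ J := by
  have hbN : b < N := by simpa using hN _ B.last_mem (mem_insert_self b S)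
  obtain ⟨c, rfl⟩ : ∃ c, N = c + b := ⟨N - b, by omega⟩
  have hpos := B.pos
  have h0S := B.zero_notMem
  have hbS := B.last_notMem
  have hSN : S ⊆ range (c + b) := (subset_insert _ _).trans (hN _ B.last_mem)
  set S' := insert 0 (insert b S) with hS'
  have hr0 : rot c b 0 = b := by grind [rot]
  have hrc : rot c b c = 0 := by grind [rot]
  have hrot : ∀ z < c + b, z ≠ 0 → rot c b z ≠ b := by
    intro z hz hz0
    unfold rot
    split <;> omega
  have hrot' : ∀ z < c + b, z ≠ c → rot c b z ≠ 0 := by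
    intro z hz hz0
    unfold rot
    split <;> omega
  have e0 : rotCompl c b (insert 0 S) = insert 0 (rotCompl c b S') := by
    ext z
    simp only [mem_rotCompl, mem_insert, hS']
    rcases eq_or_ne z 0 with rfl | hz
    · rw [hr0]; grind
    · have := hrot z; grind
  have eb : rotCompl c b (insert b S) = insert c (rotCompl c b S') := by
    ext z
    simp only [mem_rotCompl, mem_insert, hS']
    rcases eq_or_ne z c with rfl | hz
    · rw [hrc]; grind
    · have := hrot' z; grind
  have hS'N : S' ⊆ range (c + b) := by
    rw [hS', insert_subset_iff, insert_subset_iff]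
    exact ⟨by simp; omega, by simp; omega, hSN⟩
  have hS'c : #S' = #S + 2 := by
    rw [hS', card_insert_of_notMem (by grind), card_insert_of_notMem hbS]
  have B' : Base (rotCompl c b '' C) c (rotCompl c b S') := by
    constructor
    · rintro _ ⟨J, hJ, rfl⟩
      have h1 := card_rotCompl (hN J hJ)
      have h2 := card_rotCompl hS'N
      have h3 := B.card J hJ
      omega
    · rintro _ ⟨J, hJ, rfl⟩ _ ⟨K, hK, rfl⟩
      exact (B.nc J hJ K hK).to_rotCompl (B.nc K hK J hJ)
    · omega
    · simp [mem_rotCompl, hr0, hS']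
    · simp [mem_rotCompl, hrc, hS']
    · exact ⟨_, B.zero_mem, e0⟩
    · exact ⟨_, B.last_mem, eb⟩
  have hmem : ∀ x, 0 < x → x < c → x ∉ rotCompl c b S' → x + b ∈ S := by
    intro x h0 hx hxS
    have : rot c b x = x + b := by simp [rot, hx]
    simp only [mem_rotCompl, this, hS', mem_insert] at hxS
    grind
  have hin : ∀ J ∈ C, rotCompl c b J ∈ Outer (rotCompl c b '' C) c (rotCompl c b S') →
      J ∈ Inner C b S := by
    rintro J hJ ⟨-, h0, hc, h⟩
    rw [mem_rotCompl, hr0] at h0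
    rw [mem_rotCompl, hrc] at hc
    refine ⟨hJ, hc.2, h0.2, fun x hx hxS => ?_⟩
    by_contra! hbx
    have hxN := mem_range.1 (hN J hJ hx)
    have hxb : x ≠ b := by grind
    have e : rot c b (x - b) = x := by grind [rot]
    have := h (x - b) (by simp only [mem_rotCompl, e, hS', mem_insert]; grind)
      (by simp only [mem_rotCompl, e]; grind)
    omega
  have hout : ∀ K ∈ Outer C b S, rotCompl c b K ∈
      Inner (rotCompl c b '' C) c (rotCompl c b S') := by
    rintro K ⟨hK, h0, hb, h⟩
    refine ⟨⟨K, hK, rfl⟩, by simp [mem_rotCompl, hr0, hb], by simp [mem_rotCompl, hrc, h0], ?_⟩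
    intro x hx hxS
    by_contra! hcx
    rw [mem_rotCompl] at hx hxS
    have e : rot c b x = x - c := by grind [rot]
    rw [e] at hx hxS
    have := h (x - c) (by grind) hx.2
    omega
  obtain ⟨y, hy, hby⟩ := hE
  have hyN := mem_range.1 (hSN hy)
  have hkey := B'.outer_of_blocked ⟨y - b, by omega, by omega, by
      have e : rot c b (y - b) = y := by grind [rot]
      simp [mem_rotCompl, e, hS', hy]⟩ (by
    intro x h0 hx hxS
    have hxS' := hmem x h0 hx hxS
    obtain ⟨J, hJ, hn⟩ := hk (x + b) hxS' (by omega)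
    refine ⟨_, ⟨J, hJ, rfl⟩, fun hc => hn ?_⟩
    have e : insert x (rotCompl c b S') = rotCompl c b (S'.erase (x + b)) := by
      ext z
      simp only [mem_insert, mem_rotCompl, mem_erase]
      have h1 : rot c b x = x + b := by simp [rot, hx]
      have h2 : z < c + b → rot c b z = x + b → z = x := by
        intro hz h
        rw [← rot_rot hz, h, ← h1, rot_rot (by omega)]
      rcases eq_or_ne z x with rfl | hz
      · grind
      · grind
    rw [e] at hc
    have hs : S'.erase (x + b) ⊆ range (c + b) := (erase_subset _ _).trans hS'N
    exact ⟨hc.1.of_rotCompl hs (hN J hJ) hc.2, hc.2.of_rotCompl (hN J hJ) hs hc.1⟩)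
  constructor
  · obtain ⟨_, hL⟩ := hkey.1
    obtain ⟨J, hJ, rfl⟩ := hL.1
    exact ⟨J, hin J hJ hL⟩
  · intro K hK
    obtain ⟨_, hL, hn⟩ := hkey.2 _ (hout K hK)
    obtain ⟨J, hJ, rfl⟩ := hL.1
    refine ⟨J, hin J hJ hL, ?_⟩
    obtain ⟨z, hz, hzJ⟩ := not_subset.1 hn
    simp only [mem_sdiff, mem_rotCompl] at hz hzJ
    have hJ' := hin J hJ hL
    have h1 := hK.2.1
    have h2 := hK.2.2.1
    refine ⟨rot c b z, ?_, hz.1.2, by tauto⟩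
    have : rot c b z ∈ S' := by tauto
    grind

end WSep

namespace WSep

variable {C : Set (Finset ℕ)} {b : ℕ} {S : Finset ℕ}

/-- Either some element of `(0, b)` can be inserted into `S`, or some element of `S` beyond `b`
can be removed from `S ∪ {0, b}`, so that the result does not cross any member of `C`. -/
theorem Base.exists_exchange (B : Base C b S) {N : ℕ} (hN : ∀ J ∈ C, J ⊆ range N)
    (h : (∃ x, 0 < x ∧ x < b ∧ x ∉ S) ∨ ∃ y ∈ S, b < y) :
    (∃ x, 0 < x ∧ x < b ∧ x ∉ S ∧
      ∀ J ∈ C, NonCross (insert x S) J ∧ NonCross J (insert x S)) ∨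
    ∃ y ∈ S, b < y ∧ ∀ J ∈ C, NonCross ((insert 0 (insert b S)).erase y) J ∧
      NonCross J ((insert 0 (insert b S)).erase y) := by
  by_contra hcon
  rw [not_or] at hcon
  obtain ⟨hx, hy⟩ := hcon
  have hx' : ∀ x, 0 < x → x < b → x ∉ S →
      ∃ J ∈ C, ¬ (NonCross (insert x S) J ∧ NonCross J (insert x S)) := by
    intro x h1 h2 h3
    by_contra! hc
    exact hx ⟨x, h1, h2, h3, hc⟩
  have hy' : ∀ y ∈ S, b < y → ∃ J ∈ C, ¬ (NonCross ((insert 0 (insert b S)).erase y) J ∧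
      NonCross J ((insert 0 (insert b S)).erase y)) := by
    intro y h1 h2
    by_contra! hc
    exact hy ⟨y, h1, h2, hc⟩
  have h0S := B.zero_notMem
  have hbS := B.last_notMem
  have hpos := B.pos
  have hlt : ∀ J ∈ Inner C b S, ∀ p ∈ J, p ∉ S → 0 < p ∧ p < b := by
    rintro J ⟨-, h0, -, hJ⟩ p hp hpS
    exact ⟨Nat.pos_of_ne_zero (by grind), hJ p hp hpS⟩
  by_cases hE : ∃ x, 0 < x ∧ x < b ∧ x ∉ S
  · obtain ⟨⟨K₀, hK₀⟩, hout⟩ := B.outer_of_blocked hE hx'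
    have hK : ∀ K ∈ Outer C b S, {0, b} ⊆ K \ S := by
      rintro K ⟨-, h0, hb, -⟩
      simp [insert_subset_iff, mem_sdiff, h0, hb, h0S, hbS]
    have hE' : ∃ y ∈ S, b < y := by
      have h1 := card_le_card (hK K₀ hK₀)
      rw [card_pair hpos.ne, B.card_sdiff hK₀.1] at h1
      obtain ⟨y, hy⟩ : (S \ K₀).Nonempty := by
        rw [← card_pos]
        omega
      rw [mem_sdiff] at hy
      exact ⟨y, hy.1, hK₀.2.2.2 y hy.1 hy.2⟩
    obtain ⟨⟨J₀, hJ₀⟩, hin⟩ := B.inner_of_blocked hN hE' hy'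
    obtain ⟨J, hJ, hmin⟩ :=
      (measure fun J : Finset ℕ => #(J \ S)).wf.has_min (Inner C b S) ⟨J₀, hJ₀⟩
    have hcross : ∀ J ∈ Inner C b S, ∀ K ∈ Outer C b S, J \ S ⊆ K ∨ S \ K ⊆ S \ J := by
      intro J hJ K hK
      by_contra! hc
      obtain ⟨⟨p, hp, hpK⟩, ⟨y, hy, hyJ⟩⟩ := And.imp not_subset.1 not_subset.1 hc
      rw [mem_sdiff] at hp hy hyJ
      have hpb := hlt J hJ p hp.1 hp.2
      exact B.nc K hK.1 J hJ.1 0 p b y hpb.1 hpb.2 (hK.2.2.2 y hy.1 hy.2) hK.2.1 hJ.2.1 hp.1 hpK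
        hK.2.2.1 hJ.2.2.1 (by tauto) hy.2
    obtain ⟨K, hKo, hJK⟩ := hout J hJ
    have h1 := card_le_card ((hcross J hJ K hKo).resolve_left hJK)
    obtain ⟨L, hL, y, hyS, hyK, hyL⟩ := hin K hKo
    have h2 : L \ S ⊆ K := (hcross L hL K hKo).resolve_right fun hc => by
      have := hc (mem_sdiff.2 ⟨hyS, hyK⟩)
      exact (mem_sdiff.1 this).2 hyL
    have h3 : L \ S ⊆ (K \ S) \ {0, b} := by
      intro p hp
      have hp' := mem_sdiff.1 hp
      have := hlt L hL p hp'.1 hp'.2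
      simp only [mem_sdiff, mem_insert, mem_singleton]
      exact ⟨⟨h2 hp, hp'.2⟩, by omega⟩
    have h4 := card_le_card h3
    have h5 := card_sdiff_add_card_eq_card (hK K hKo)
    rw [card_pair hpos.ne] at h5
    have h6 := B.card_sdiff hKo.1
    have h7 := B.card_sdiff hJ.1
    exact hmin L hL (show #(L \ S) < #(J \ S) by omega)
  · obtain ⟨J, hJ⟩ := (B.inner_of_blocked hN (h.resolve_left hE) hy').1
    have h1 := B.card_sdiff hJ.1
    obtain ⟨p, hp⟩ : (J \ S).Nonempty := by
      rw [← card_pos]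
      omega
    rw [mem_sdiff] at hp
    have := hlt J hJ p hp.1 hp.2
    exact hE ⟨p, this.1, this.2, hp.2⟩

end WSep

namespace WSep

/-- No element of `A \ B` lies between two elements of `B \ A`. -/
def NoSurround (A B : Finset ℕ) : Prop :=
  ∀ x y z, x < y → y < z → x ∈ B → x ∉ A → y ∈ A → y ∉ B → z ∈ B → z ∉ A → False

/-- Weak separation in terms of forbidden patterns. -/
def WS (A B : Finset ℕ) : Prop := (#A ≤ #B ∧ NoSurround A B) ∨ (#B ≤ #A ∧ NoSurround B A)

theorem WS.symm {A B : Finset ℕ} (h : WS A B) : WS B A := Or.symm h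

theorem WS.refl (A : Finset ℕ) : WS A A :=
  .inl ⟨le_rfl, fun _ _ _ _ _ h h' => absurd h h'⟩

theorem WS.noSurround {A B : Finset ℕ} (h : WS A B) (hc : #A < #B) : NoSurround A B := by
  rcases h with h | h
  · exact h.2
  · omega

/-- The encoding of subsets of `[1, n]` of arbitrary size by subsets of `[0, 2n)` of size `n`:
`n` is sent to `0`, the other elements are shifted by `n`, and the space in between is padded. -/
def enc (n : ℕ) (Z : Finset ℕ) : Finset ℕ :=
  {w ∈ range (2 * n) | (w = 0 ∧ n ∈ Z) ∨ (1 ≤ w ∧ w + #Z ≤ n) ∨ (n < w ∧ w - n ∈ Z)}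

theorem mem_enc {n : ℕ} {Z : Finset ℕ} {w : ℕ} : w ∈ enc n Z ↔ w < 2 * n ∧
    ((w = 0 ∧ n ∈ Z) ∨ (1 ≤ w ∧ w + #Z ≤ n) ∨ (n < w ∧ w - n ∈ Z)) := by
  simp [enc]

theorem enc_subset {n : ℕ} {Z : Finset ℕ} : enc n Z ⊆ range (2 * n) := filter_subset _ _

theorem card_enc {n : ℕ} {Z : Finset ℕ} (hZ : Z ⊆ Icc 1 n) : #(enc n Z) = n := by
  have hle : #Z ≤ n := by simpa using card_le_card hZ
  have hz : ∀ z ∈ Z, 1 ≤ z ∧ z ≤ n := fun z h => mem_Icc.1 (hZ h)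
  have h : enc n Z = Icc 1 (n - #Z) ∪ Z.image fun z => if z = n then 0 else z + n := by
    ext w
    simp only [mem_enc, mem_union, mem_Icc, mem_image]
    constructor
    · rintro ⟨h, ⟨rfl, h'⟩ | h' | ⟨h1, h2⟩⟩
      · exact .inr ⟨n, h', by simp⟩
      · left; omega
      · exact .inr ⟨w - n, h2, by split <;> omega⟩
    · rintro (h | ⟨z, h, rfl⟩)
      · have hn : 0 < n := by omega
        exact ⟨by omega, .inr (.inl ⟨h.1, by omega⟩)⟩
      · have := hz z h
        split
        · subst z
          exact ⟨by omega, .inl ⟨rfl, h⟩⟩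
        · exact ⟨by omega, .inr (.inr ⟨by omega, by simpa using h⟩)⟩
  rw [h, card_union_of_disjoint, card_image_of_injOn, Nat.card_Icc]
  · omega
  · intro z h z' h'
    have := hz z h
    have := hz z' h'
    dsimp only
    split <;> split <;> omega
  · rw [disjoint_left]
    intro w h1 h2
    rw [mem_Icc] at h1
    obtain ⟨z, h, rfl⟩ := mem_image.1 h2
    have := hz z h
    split at h1 <;> omega

/-- A pair of subsets of `[1, n]` alternating four times has crossing encodings. -/
theorem enc_nonCross {n : ℕ} {A B : Finset ℕ} (h1 : NonCross (enc n A) (enc n B))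
    (h2 : NonCross (enc n B) (enc n A)) (hA : A ⊆ Icc 1 n) (hB : B ⊆ Icc 1 n) : NonCross A B := by
  intro w₁ w₂ w₃ w₄ l₁ l₂ l₃ a₁ b₁ a₂ b₂ a₃ b₃ a₄ b₄
  have := mem_Icc.1 (hA a₁)
  have := mem_Icc.1 (hB a₄)
  rcases eq_or_ne w₄ n with rfl | h
  · refine h2 0 (w₁ + w₄) (w₂ + w₄) (w₃ + w₄) ?_ ?_ ?_ ?_ ?_ ?_ ?_ ?_ ?_ ?_ ?_
    all_goals
      try simp only [mem_enc, Nat.add_sub_cancel]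
      first | omega | grind
  · refine h1 (w₁ + n) (w₂ + n) (w₃ + n) (w₄ + n) ?_ ?_ ?_ ?_ ?_ ?_ ?_ ?_ ?_ ?_ ?_
    all_goals
      try simp only [mem_enc, Nat.add_sub_cancel]
      first | omega | grind

theorem noSurround_of_enc {n : ℕ} {A B : Finset ℕ} (h1 : NonCross (enc n A) (enc n B))
    (h2 : NonCross (enc n B) (enc n A)) (hA : A ⊆ Icc 1 n) (hB : B ⊆ Icc 1 n) (hc : #A < #B) :
    NoSurround A B := by
  intro x y z l₁ l₂ a₁ b₁ a₂ b₂ a₃ b₃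
  have := mem_Icc.1 (hB a₁)
  have := mem_Icc.1 (hB a₃)
  have hle : #B ≤ n := by simpa using card_le_card hB
  rcases eq_or_ne z n with rfl | h
  · refine h2 0 (z - #A) (x + z) (y + z) ?_ ?_ ?_ ?_ ?_ ?_ ?_ ?_ ?_ ?_ ?_
    all_goals
      try simp only [mem_enc, Nat.add_sub_cancel]
      first | omega | grind
  · refine h1 (n - #A) (x + n) (y + n) (z + n) ?_ ?_ ?_ ?_ ?_ ?_ ?_ ?_ ?_ ?_ ?_
    all_goals
      try simp only [mem_enc, Nat.add_sub_cancel]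
      first | omega | grind

theorem ws_of_enc {n : ℕ} {A B : Finset ℕ} (h1 : NonCross (enc n A) (enc n B))
    (h2 : NonCross (enc n B) (enc n A)) (hA : A ⊆ Icc 1 n) (hB : B ⊆ Icc 1 n) : WS A B := by
  rcases lt_trichotomy #A #B with h | h | h
  · exact .inl ⟨h.le, noSurround_of_enc h1 h2 hA hB h⟩
  · by_contra hc
    simp only [WS, h, le_rfl, true_and, not_or, NoSurround] at hc
    push Not at hc
    obtain ⟨⟨x, y, z, l₁, l₂, a₁, b₁, a₂, b₂, a₃, b₃, -⟩,
      ⟨p, q, r, m₁, m₂, c₁, d₁, c₂, d₂, c₃, d₃, -⟩⟩ := hc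
    rcases lt_or_gt_of_ne (show x ≠ p by grind) with g | g
    · exact enc_nonCross h2 h1 hB hA x p q r g m₁ m₂ a₁ b₁ c₁ d₁ c₂ d₂ c₃ d₃
    · exact enc_nonCross h1 h2 hA hB p x y z g l₁ l₂ c₁ d₁ a₁ b₁ a₂ b₂ a₃ b₃
  · exact .inr ⟨h.le, noSurround_of_enc h2 h1 hB hA h⟩

theorem NoSurround.enc {n : ℕ} {A B : Finset ℕ} (h : NoSurround A B) (hc : #A ≤ #B)
    (hA : A ⊆ Icc 1 n) (hB : B ⊆ Icc 1 n) :
    NonCross (enc n A) (enc n B) ∧ NonCross (enc n B) (enc n A) := by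
  constructor
  · intro w₁ w₂ w₃ w₄ l₁ l₂ l₃ a₁ b₁ a₂ b₂ a₃ b₃ a₄ b₄
    simp only [mem_enc] at a₁ b₁ a₂ b₂ a₃ b₃ a₄ b₄
    have e₂ : n < w₂ := by
      obtain ⟨h', h'' | h'' | h''⟩ := a₂
      exacts [by omega, absurd ⟨h', .inr (.inl ⟨h''.1, by omega⟩)⟩ b₂, h''.1]
    refine h (w₂ - n) (w₃ - n) (w₄ - n) ?_ ?_ ?_ ?_ ?_ ?_ ?_ ?_ <;> first | omega | grind
  · intro w₁ w₂ w₃ w₄ l₁ l₂ l₃ a₁ b₁ a₂ b₂ a₃ b₃ a₄ b₄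
    simp only [mem_enc] at a₁ b₁ a₂ b₂ a₃ b₃ a₄ b₄
    rcases eq_or_ne w₁ 0 with rfl | h0
    · have e₃ : n < w₃ := by
        obtain ⟨h', h'' | h'' | h''⟩ := a₃
        exacts [by omega, absurd ⟨h', .inr (.inl ⟨h''.1, by omega⟩)⟩ b₃, h''.1]
      refine h (w₃ - n) (w₄ - n) n ?_ ?_ ?_ ?_ ?_ ?_ ?_ ?_ <;> first | omega | grind
    · have e₁ : n < w₁ := by
        obtain ⟨h', h'' | h'' | h''⟩ := a₁
        exacts [by omega, absurd ⟨h', .inr (.inl ⟨h''.1, by omega⟩)⟩ b₁, h''.1]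
      refine h (w₁ - n) (w₂ - n) (w₃ - n) ?_ ?_ ?_ ?_ ?_ ?_ ?_ ?_ <;> first | omega | grind

theorem ws_iff_enc {n : ℕ} {A B : Finset ℕ} (hA : A ⊆ Icc 1 n) (hB : B ⊆ Icc 1 n) :
    WS A B ↔ NonCross (enc n A) (enc n B) ∧ NonCross (enc n B) (enc n A) := by
  refine ⟨fun h => ?_, fun h => ws_of_enc h.1 h.2 hA hB⟩
  rcases h with h | h
  · exact h.2.enc h.1 hA hB
  · exact (h.2.enc h.1 hB hA).symm

end WSep

namespace WSep

/-- `C` is a maximal weakly separated collection of subsets of `[1, n]`. -/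
structure MaxWS (n : ℕ) (C : Set (Finset ℕ)) : Prop where
  sub : ∀ A ∈ C, A ⊆ Icc 1 n
  ws : ∀ A ∈ C, ∀ B ∈ C, WS A B
  max : ∀ Z ⊆ Icc 1 n, (∀ A ∈ C, WS Z A) → Z ∈ C

variable {n m : ℕ} {C : Set (Finset ℕ)}

theorem MaxWS.base (H : MaxWS n C) {b : ℕ} {X Z : Finset ℕ} (hX : X ∈ C) (hZ : Z ∈ C)
    (hb : 0 < b) (hbX : b ∈ enc n X) (h0 : 0 ∉ enc n X)
    (h : insert 0 ((enc n X).erase b) = enc n Z) : Base (enc n '' C) b ((enc n X).erase b) where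
  card := by
    rintro _ ⟨J, hJ, rfl⟩
    rw [card_erase_add_one hbX, card_enc (H.sub _ hX), card_enc (H.sub _ hJ)]
  nc := by
    rintro _ ⟨J, hJ, rfl⟩ _ ⟨K, hK, rfl⟩
    exact ((ws_iff_enc (H.sub _ hJ) (H.sub _ hK)).1 (H.ws _ hJ _ hK)).1
  pos := hb
  zero_notMem := by simp [h0]
  last_notMem := by simp
  zero_mem := ⟨Z, hZ, h.symm⟩
  last_mem := ⟨X, hX, (insert_erase hbX).symm⟩

theorem MaxWS.mem_of_enc (H : MaxWS n C) {Z W : Finset ℕ} (hZ : Z ⊆ Icc 1 n) (hW : W = enc n Z)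
    (h : ∀ J ∈ enc n '' C, NonCross W J ∧ NonCross J W) : Z ∈ C := by
  subst hW
  exact H.max Z hZ fun A hA => (ws_iff_enc hZ (H.sub _ hA)).2 (h _ ⟨A, hA, rfl⟩)

/-- If `P` and `P ∪ {n}` belong to `C`, then so does `(P \ {d}) ∪ {n}` for some `d ∈ P`. -/
theorem MaxWS.exists_erase (H : MaxWS (m + 1) C) {P : Finset ℕ} (hP : P ⊆ Icc 1 m)
    (hPC : P ∈ C) (hPn : insert (m + 1) P ∈ C) (hne : P.Nonempty) :
    ∃ d ∈ P, insert (m + 1) (P.erase d) ∈ C := by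
  have hle : #P ≤ m := by simpa using card_le_card hP
  have hp : ∀ z ∈ P, 1 ≤ z ∧ z ≤ m := fun z h => mem_Icc.1 (hP h)
  have hmP : m + 1 ∉ P := fun h => by have := hp _ h; omega
  have hbX : m + 1 - #P ∈ enc (m + 1) P := by
    rw [mem_enc]
    have := hne.card_pos
    omega
  have e0 : insert 0 ((enc (m + 1) P).erase (m + 1 - #P)) = enc (m + 1) (insert (m + 1) P) := by
    ext w
    simp only [mem_insert, mem_erase, mem_enc, card_insert_of_notMem hmP]
    grind
  have B := H.base hPC hPn (by omega) hbX (by simp [mem_enc, hmP]) e0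
  have hN : ∀ J ∈ enc (m + 1) '' C, J ⊆ range (2 * (m + 1)) := by
    rintro _ ⟨J, -, rfl⟩
    exact enc_subset
  obtain ⟨e, he⟩ := id hne
  have hpe := hp e he
  rcases B.exists_exchange hN (.inr ⟨m + 1 + e, by
    rw [mem_erase, mem_enc, Nat.add_sub_cancel_left]
    exact ⟨by omega, by omega, .inr (.inr ⟨by omega, he⟩)⟩, by omega⟩) with
    ⟨x, h1, h2, h3, -⟩ | ⟨y, h1, h2, h3⟩
  · rw [mem_erase, mem_enc] at h3
    omega
  · rw [mem_erase, mem_enc] at h1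
    have hd : m + 1 < y ∧ y - (m + 1) ∈ P := by
      rcases h1.2.2 with h | h | h
      exacts [absurd h.2 hmP, by omega, h]
    refine ⟨y - (m + 1), hd.2, H.mem_of_enc ?_ ?_ h3⟩
    · intro z hz
      rw [mem_insert, mem_erase] at hz
      rw [mem_Icc]
      rcases hz with rfl | hz
      · omega
      · have := hp z hz.2
        omega
    · rw [insert_erase hbX]
      ext w
      have hc := card_erase_add_one hd.2
      have : #(insert (m + 1) (P.erase (y - (m + 1)))) = #P := by
        rw [card_insert_of_notMem (by simp [hmP]), hc]
      simp only [mem_insert, mem_erase, mem_enc, this]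
      grind

/-- Lowering a pad preserves noncrossing with an encoding. -/
theorem NonCross.lower_pad {Z S : Finset ℕ} {p x : ℕ} (hpx : p ≤ x) (hxn : x ≤ n) (hp : 0 < p)
    (hS : 0 ∉ S) (hpS : ∀ w, 0 < w → w ≤ n → w ∈ S → w < p)
    (hpS' : ∀ w, 0 < w → w < p → w ∈ S)
    (h1 : NonCross (insert x S) (enc n Z)) (h2 : NonCross (enc n Z) (insert x S)) :
    NonCross (insert p S) (enc n Z) ∧ NonCross (enc n Z) (insert p S) := by
  have hJ : ∀ w, 0 < w → w ≤ n → w < 2 * n → (w ∈ enc n Z ↔ w + #Z ≤ n) := by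
    intro w _ _ _
    rw [mem_enc]
    constructor
    · rintro ⟨-, h | h | h⟩ <;> omega
    · intro h
      exact ⟨by omega, .inr (.inl ⟨by omega, h⟩)⟩
  have hJ' : ∀ w ∈ enc n Z, w < 2 * n := fun w hw => mem_range.1 (enc_subset hw)
  generalize enc n Z = J at *
  rcases eq_or_ne p x with rfl | hne
  · exact ⟨h1, h2⟩
  have hxS : x ∉ S := fun h => by have := hpS x (by omega) hxn h; omega
  have hpS0 : p ∉ S := fun h => by have := hpS p (by omega) (by omega) h; omega
  by_cases hpJ : p ∈ J
  · have hlow : ∀ w ∈ insert p S, w ∉ J → n < w := by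
      intro w hw hwJ
      by_contra! hwn
      rw [mem_insert] at hw
      have hw0 : 0 < w := Nat.pos_of_ne_zero (by grind)
      have := hpS w hw0 hwn (by grind)
      have := (hJ p hp (by omega) (by omega)).1 hpJ
      exact hwJ ((hJ w hw0 hwn (by omega)).2 (by omega))
    constructor
    · intro w₁ w₂ w₃ w₄ l₁ l₂ l₃ a₁ b₁ a₂ b₂ a₃ b₃ a₄ b₄
      have := hlow w₁ a₁ b₁
      exact h1 w₁ w₂ w₃ w₄ l₁ l₂ l₃ (by grind) b₁ a₂ (by grind) (by grind) b₃ a₄ (by grind)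
    · intro w₁ w₂ w₃ w₄ l₁ l₂ l₃ a₁ b₁ a₂ b₂ a₃ b₃ a₄ b₄
      have := hlow w₂ a₂ b₂
      by_cases hw : w₁ = x
      · exact h2 p w₂ w₃ w₄ (by omega) l₂ l₃ hpJ (by grind) (by grind) b₂ a₃ (by grind)
          (by grind) b₄
      · exact h2 w₁ w₂ w₃ w₄ l₁ l₂ l₃ a₁ (by grind) (by grind) b₂ a₃ (by grind) (by grind) b₄
  · have hlow : ∀ w ∈ J, w ∉ insert p S → w = 0 ∨ n < w := by
      intro w hwJ hw
      by_contra! hc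
      have hw0 := Nat.pos_of_ne_zero hc.1
      have := hJ' w hwJ
      have := (hJ w hw0 hc.2 this).1 hwJ
      rw [mem_insert, not_or] at hw
      have : p ≤ w := not_lt.1 fun h => hw.2 (hpS' w hw0 h)
      exact hpJ ((hJ p hp (by omega) (by omega)).2 (by omega))
    have hxJ : x ∉ J := by
      intro h
      have := hlow x h (by simp [hne.symm, hxS])
      omega
    constructor
    · intro w₁ w₂ w₃ w₄ l₁ l₂ l₃ a₁ b₁ a₂ b₂ a₃ b₃ a₄ b₄
      have := hlow w₂ a₂ b₂
      by_cases hw : w₁ = p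
      · exact h1 x w₂ w₃ w₄ (by omega) l₂ l₃ (by grind) hxJ a₂ (by grind) (by grind) b₃ a₄
          (by grind)
      · exact h1 w₁ w₂ w₃ w₄ l₁ l₂ l₃ (by grind) b₁ a₂ (by grind) (by grind) b₃ a₄ (by grind)
    · intro w₁ w₂ w₃ w₄ l₁ l₂ l₃ a₁ b₁ a₂ b₂ a₃ b₃ a₄ b₄
      have := hlow w₁ a₁ b₁
      have := hlow w₃ a₃ b₃
      by_cases hw : w₂ = p
      · exact h2 w₁ x w₃ w₄ (by omega) (by omega) l₃ a₁ (by grind) (by grind) hxJ a₃ (by grind)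
          (by grind) b₄
      · exact h2 w₁ w₂ w₃ w₄ l₁ l₂ l₃ a₁ (by grind) (by grind) b₂ a₃ (by grind) (by grind) b₄

/-- The exchange property along an edge from `Y ∪ {n}` to `Y ∪ {y}`. -/
theorem MaxWS.exists_edge (H : MaxWS (m + 1) C) {Y : Finset ℕ} {y : ℕ} (hX : insert y Y ⊆ Icc 1 m)
    (hy : y ∉ Y) (hYn : insert (m + 1) Y ∈ C) (hXC : insert y Y ∈ C) :
    Y ∈ C ∨ (∃ c < y, c ∉ Y ∧ insert c Y ∈ C) ∨
      ∃ c ∈ Y, y < c ∧ insert (m + 1) ((insert y Y).erase c) ∈ C := by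
  have hcX : #(insert y Y) = #Y + 1 := card_insert_of_notMem hy
  have hle : #(insert y Y) ≤ m := by simpa using card_le_card hX
  have hp : ∀ z ∈ insert y Y, 1 ≤ z ∧ z ≤ m := fun z h => mem_Icc.1 (hX h)
  have hpy := hp y (mem_insert_self y Y)
  have hmX : m + 1 ∉ insert y Y := fun h => by have := hp _ h; omega
  have hmY : m + 1 ∉ Y := fun h => hmX (mem_insert_of_mem h)
  have hcn : #(insert (m + 1) Y) = #Y + 1 := card_insert_of_notMem hmY
  have hbX : m + 1 + y ∈ enc (m + 1) (insert y Y) := by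
    rw [mem_enc, Nat.add_sub_cancel_left]
    exact ⟨by omega, .inr (.inr ⟨by omega, mem_insert_self y Y⟩)⟩
  have hS : ∀ w, w ∈ (enc (m + 1) (insert y Y)).erase (m + 1 + y) ↔ w < 2 * (m + 1) ∧
      ((1 ≤ w ∧ w + #Y ≤ m) ∨ (m + 1 < w ∧ w - (m + 1) ∈ Y)) := by
    intro w
    simp only [mem_erase, mem_enc, hcX, mem_insert]
    grind
  have e0 : insert 0 ((enc (m + 1) (insert y Y)).erase (m + 1 + y)) =
      enc (m + 1) (insert (m + 1) Y) := by
    ext w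
    simp only [mem_insert, hS, mem_enc, hcn]
    grind
  have B := H.base hXC hYn (by omega) hbX (by simp only [mem_enc]; grind) e0
  have hN : ∀ J ∈ enc (m + 1) '' C, J ⊆ range (2 * (m + 1)) := by
    rintro _ ⟨J, -, rfl⟩
    exact enc_subset
  rcases B.exists_exchange hN (.inl ⟨m + 1 - #Y, by omega, by omega, by rw [hS]; omega⟩) with
    ⟨x, h1, h2, h3, h4⟩ | ⟨c, h1, h2, h3⟩
  · rcases le_or_gt x (m + 1) with hx | hx
    · left
      refine H.mem_of_enc (fun z hz => ?_) (W := insert (m + 1 - #Y)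
        ((enc (m + 1) (insert y Y)).erase (m + 1 + y))) ?_ ?_
      · have := hp z (mem_insert_of_mem hz)
        rw [mem_Icc]
        omega
      · ext w
        simp only [mem_insert, hS, mem_enc]
        grind
      · rintro _ ⟨A, hA, rfl⟩
        have := h4 _ ⟨A, hA, rfl⟩
        rw [hS] at h3
        refine NonCross.lower_pad (x := x) (by omega) hx (by omega) (by rw [hS]; omega)
          (fun w _ _ hw => ?_) (fun w _ _ => ?_) this.1 this.2
        · rw [hS] at hw; omega
        · rw [hS]; omega
    · right; left
      refine ⟨x - (m + 1), by omega, fun h => h3 ?_, H.mem_of_enc ?_ ?_ h4⟩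
      · rw [hS]
        exact ⟨by omega, .inr ⟨hx, h⟩⟩
      · intro z hz
        rw [mem_insert] at hz
        rw [mem_Icc]
        rcases hz with rfl | hz
        · omega
        · have := hp z (mem_insert_of_mem hz)
          omega
      · have : x - (m + 1) ∉ Y := fun h => h3 (by rw [hS]; exact ⟨by omega, .inr ⟨hx, h⟩⟩)
        ext w
        simp only [mem_insert, hS, mem_enc, card_insert_of_notMem this]
        grind
  · right; right
    rw [hS] at h1
    have hc : m + 1 < c ∧ c - (m + 1) ∈ Y := h1.2.resolve_left (by omega)
    have hcX' : c - (m + 1) ∈ insert y Y := mem_insert_of_mem hc.2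
    refine ⟨c - (m + 1), hc.2, by omega, H.mem_of_enc ?_ ?_ h3⟩
    · intro z hz
      rw [mem_insert, mem_erase] at hz
      rw [mem_Icc]
      rcases hz with rfl | hz
      · omega
      · have := hp z hz.2
        omega
    · rw [insert_erase hbX]
      ext w
      have : #(insert (m + 1) ((insert y Y).erase (c - (m + 1)))) = #Y + 1 := by
        rw [card_insert_of_notMem (by simp only [mem_erase]; tauto), card_erase_add_one hcX', hcX]
      simp only [mem_insert, mem_erase, mem_enc, this, hcX]
      grind

end WSep

namespace WSep

/-- Every element of `A \ B` is smaller than every element of `B \ A`. -/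
def Prec (A B : Finset ℕ) : Prop := ∀ a ∈ A, a ∉ B → ∀ b ∈ B, b ∉ A → a < b

theorem Prec.ws {A B : Finset ℕ} (h : Prec A B) : WS A B := by
  rcases le_total #A #B with hc | hc
  · exact .inl ⟨hc, fun x y z l₁ l₂ a₁ b₁ a₂ b₂ _ _ => by have := h y a₂ b₂ x a₁ b₁; omega⟩
  · exact .inr ⟨hc, fun x y z l₁ l₂ _ _ a₂ b₂ a₃ b₃ => by have := h z a₃ b₃ y a₂ b₂; omega⟩

theorem Prec.antisymm {A B : Finset ℕ} (h : Prec A B) (h' : Prec B A) (hc : #A = #B) : A = B := by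
  by_contra hne
  obtain ⟨a, ha, ha'⟩ := not_subset.1 fun hs => hne (eq_of_subset_of_card_le hs hc.ge)
  obtain ⟨b, hb, hb'⟩ := not_subset.1 fun hs => hne (eq_of_subset_of_card_le hs hc.le).symm
  have := h a ha ha' b hb hb'
  have := h' b hb hb' a ha ha'
  omega

theorem exists_sdiff {A B : Finset ℕ} (hc : #A ≤ #B) {a : ℕ} (ha : a ∈ A) (ha' : a ∉ B) :
    ∃ b ∈ B, b ∉ A := by
  by_contra! h
  exact ha' (eq_of_subset_of_card_le h hc ▸ ha)

theorem Prec.trans {A B C : Finset ℕ} (h₁ : Prec A B) (h₂ : Prec B C) (hAB : #A ≤ #B)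
    (hBC : #B ≤ #C) (h : WS A C) : Prec A C := by
  intro a ha haC c hc hcA
  by_contra! hle
  have hlt : c < a := lt_of_le_of_ne hle (by grind)
  by_cases haB : a ∈ B
  · have hcB : c ∈ B := by
      by_contra hcB
      have := h₂ a haB haC c hc hcB
      omega
    obtain ⟨y, hy, hyB⟩ := exists_sdiff hBC haB haC
    have hay := h₂ a haB haC y hy hyB
    have hyA : y ∉ A := fun hyA => by have := h₁ y hyA hyB c hcB hcA; omega
    rcases h with ⟨-, h⟩ | ⟨hCA, h⟩
    · exact h c a y hlt hay hc hcA ha haC hy hyA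
    · obtain ⟨x, hx, hxB⟩ := exists_sdiff (A := B) (B := A) (by omega) hcB hcA
      have hxc := h₁ x hx hxB c hcB hcA
      have hxC : x ∉ C := fun hxC => by have := h₂ a haB haC x hxC hxB; omega
      exact h x c a hxc hlt hx hxC hc hcA ha haC
  · have hcB : c ∉ B := fun hcB => by have := h₁ a ha haB c hcB hcA; omega
    obtain ⟨b, hb, hbA⟩ := exists_sdiff hAB ha haB
    have hab := h₁ a ha haB b hb hbA
    have hbC : b ∈ C := by
      by_contra hbC
      have := h₂ b hb hbC c hc hcB
      omega
    rcases h with ⟨-, h⟩ | ⟨hCA, h⟩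
    · exact h c a b hlt hab hc hcA ha haC hbC hbA
    · obtain ⟨x, hx, hxC⟩ := exists_sdiff (A := C) (B := B) (by omega) hc hcB
      have hxc := h₂ x hx hxC c hc hcB
      have hxA : x ∈ A := by
        by_contra hxA
        have := h₁ a ha haB x hx hxA
        omega
      exact h x c a hxc hlt hxA hxC hc hcA ha haC

variable {m : ℕ} {X Y : Finset ℕ}

theorem notMem_of_subset_Icc (hX : X ⊆ Icc 1 m) : m + 1 ∉ X := fun h => by
  have := mem_Icc.1 (hX h)
  omega

theorem prec_of_ws_insert (hX : X ⊆ Icc 1 m) (hY : Y ⊆ Icc 1 m) (hc : #X ≤ #Y)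
    (h : WS X (insert (m + 1) Y)) : Prec X Y := by
  intro x hx hxY y hy hyX
  by_contra! hle
  have hX' := notMem_of_subset_Icc hX
  have hY' := notMem_of_subset_Icc hY
  have := mem_Icc.1 (hX hx)
  have hn := h.noSurround (by rw [card_insert_of_notMem hY']; omega)
  exact hn y x (m + 1) (lt_of_le_of_ne hle (by grind)) (by omega) (by simp [hy]) hyX hx
    (by simp only [mem_insert]; grind) (by simp) hX'

theorem Prec.ws_insert (hX : X ⊆ Icc 1 m) (hc : #X ≤ #Y) (h : Prec X Y) :
    WS X (insert (m + 1) Y) := by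
  refine .inl ⟨hc.trans (card_le_card (subset_insert _ _)), ?_⟩
  intro x y z l₁ l₂ a₁ b₁ a₂ b₂ a₃ b₃
  have := mem_Icc.1 (hX a₂)
  rw [mem_insert] at a₁ b₂
  have := h y a₂ (by tauto) x (a₁.resolve_left (by omega)) b₁
  omega

theorem ws_insert_iff (hX : X ⊆ Icc 1 m) (hY : Y ⊆ Icc 1 m) (hc : #Y < #X) :
    WS X (insert (m + 1) Y) ↔ WS X Y := by
  have hX' := notMem_of_subset_Icc hX
  have hY' := notMem_of_subset_Icc hY
  have hcY : #(insert (m + 1) Y) = #Y + 1 := card_insert_of_notMem hY'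
  have key : NoSurround (insert (m + 1) Y) X ↔ NoSurround Y X := by
    constructor <;> intro h x y z l₁ l₂ a₁ b₁ a₂ b₂ a₃ b₃
    · have := mem_Icc.1 (hX a₁)
      have := mem_Icc.1 (hX a₃)
      refine h x y z l₁ l₂ a₁ ?_ (mem_insert_of_mem a₂) b₂ a₃ ?_ <;> rw [mem_insert] <;> grind
    · have := mem_Icc.1 (hX a₃)
      rw [mem_insert] at a₂ b₁ b₃
      exact h x y z l₁ l₂ a₁ (by tauto) (a₂.resolve_left (by omega)) b₂ a₃ (by tauto)
  constructor
  · rintro (⟨h1, h⟩ | ⟨-, h⟩)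
    · right
      refine ⟨hc.le, fun x y z l₁ l₂ a₁ b₁ a₂ b₂ a₃ b₃ => ?_⟩
      have := mem_Icc.1 (hX a₃)
      exact h y z (m + 1) l₂ (by omega) (mem_insert_of_mem a₂) b₂ a₃
        (by rw [mem_insert]; grind) (mem_insert_self _ _) hX'
    · exact .inr ⟨hc.le, key.1 h⟩
  · exact fun h => .inr ⟨by omega, key.2 (h.symm.noSurround hc)⟩

theorem noSurround_insert_insert_iff {e : ℕ} (hX : e ∉ X) (hY : e ∉ Y) :
    NoSurround (insert e X) (insert e Y) ↔ NoSurround X Y := by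
  constructor <;> intro h x y z l₁ l₂ a₁ b₁ a₂ b₂ a₃ b₃
  · refine h x y z l₁ l₂ ?_ ?_ ?_ ?_ ?_ ?_ <;> rw [mem_insert] <;> grind
  · rw [mem_insert] at a₁ a₂ a₃ b₁ b₂ b₃
    exact h x y z l₁ l₂ (by tauto) (by tauto) (by tauto) (by tauto) (by tauto) (by tauto)

theorem ws_insert_insert_iff {e : ℕ} (hX : e ∉ X) (hY : e ∉ Y) :
    WS (insert e X) (insert e Y) ↔ WS X Y := by
  simp only [WS, noSurround_insert_insert_iff hX hY, noSurround_insert_insert_iff hY hX,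
    card_insert_of_notMem hX, card_insert_of_notMem hY, add_le_add_iff_right]

end WSep

namespace WSep

variable {n m : ℕ} {C : Set (Finset ℕ)} {X Y Z : Finset ℕ}

/-- `P` and `P ∪ {m + 1}` both belong to `C`. -/
def IsPair (m : ℕ) (C : Set (Finset ℕ)) (P : Finset ℕ) : Prop :=
  P ⊆ Icc 1 m ∧ P ∈ C ∧ insert (m + 1) P ∈ C

theorem MaxWS.prec (H : MaxWS (m + 1) C) (hX : X ⊆ Icc 1 m) (hXC : X ∈ C) (hY : Y ⊆ Icc 1 m)
    (hYC : insert (m + 1) Y ∈ C) (hc : #X ≤ #Y) : Prec X Y :=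
  prec_of_ws_insert hX hY hc (H.ws _ hXC _ hYC)

theorem MaxWS.isPair_top (H : MaxWS (m + 1) C) : IsPair m C (Icc 1 m) := by
  have h1 : Icc 1 m ⊆ Icc 1 (m + 1) := Icc_subset_Icc le_rfl (by omega)
  refine ⟨Subset.rfl, H.max _ h1 fun A hA => ?_,
    H.max _ (insert_subset (by simp) h1) fun A hA => ?_⟩
  · rcases le_total #(Icc 1 m) #A with hc | hc
    · left
      refine ⟨hc, fun x y z l₁ l₂ a₁ b₁ a₂ b₂ a₃ b₃ => ?_⟩
      have := mem_Icc.1 (H.sub A hA a₁)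
      rw [mem_Icc] at b₁ a₂
      omega
    · right
      refine ⟨hc, fun x y z l₁ l₂ a₁ b₁ a₂ b₂ a₃ b₃ => ?_⟩
      have := mem_Icc.1 (H.sub A hA a₂)
      rw [mem_Icc] at b₂ a₃
      omega
  · right
    have hs : A ⊆ insert (m + 1) (Icc 1 m) := fun z hz => by
      have := mem_Icc.1 (H.sub A hA hz)
      rw [mem_insert, mem_Icc]
      omega
    exact ⟨card_le_card hs, fun x y z l₁ l₂ a₁ b₁ a₂ b₂ a₃ b₃ => b₂ (hs a₂)⟩

/-- Descending along edges yields a pair one level below a given one. -/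
theorem MaxWS.isPair_of_edge (H : MaxWS (m + 1) C) (Y : Finset ℕ) (y : ℕ)
    (hX : insert y Y ⊆ Icc 1 m) (hy : y ∉ Y) (hYn : insert (m + 1) Y ∈ C) (hXC : insert y Y ∈ C) :
    ∃ P c, IsPair m C P ∧ c ∉ P ∧ insert c P ∈ C ∧ insert c P ⊆ Icc 1 m ∧ #P = #Y := by
  have hmY := notMem_of_subset_Icc ((subset_insert y Y).trans hX)
  rcases H.exists_edge hX hy hYn hXC with h | ⟨c, hc, hcY, h⟩ | ⟨c, hcY, hc, h⟩
  · exact ⟨Y, y, ⟨(subset_insert y Y).trans hX, h, hYn⟩, hy, hXC, hX, rfl⟩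
  · have hsub : insert c Y ⊆ Icc 1 m := by
      have hs := H.sub _ h
      have hz := mem_Icc.1 (hs (mem_insert_self c Y))
      have hy' := mem_Icc.1 (hX (mem_insert_self y Y))
      exact insert_subset (mem_Icc.2 (by omega)) ((subset_insert y Y).trans hX)
    exact H.isPair_of_edge Y c hsub hcY hYn h
  · have hcX : c ∈ insert y Y := mem_insert_of_mem hcY
    have hdec : (∑ z ∈ (insert y Y).erase c, z) + c < (∑ z ∈ Y, z) + c := by
      rw [sum_erase_add _ _ hcX, sum_insert hy]
      omega
    obtain ⟨P, d, h1, h2, h3, h4, h5⟩ := H.isPair_of_edge ((insert y Y).erase c) c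
      (by rwa [insert_erase hcX]) (by simp) h (by rwa [insert_erase hcX])
    refine ⟨P, d, h1, h2, h3, h4, ?_⟩
    have := card_erase_add_one hcX
    rw [card_insert_of_notMem hy] at this
    omega
termination_by (∑ z ∈ Y, z) + ((∑ z ∈ Y, z) + y)
decreasing_by
  · omega
  · have h1 : ∑ z ∈ (insert y Y).erase c, z + c = y + ∑ z ∈ Y, z := by
      rw [sum_erase_add _ _ hcX, sum_insert hy]
    omega

theorem MaxWS.exists_isPair (H : MaxWS (m + 1) C) {j : ℕ} (hj : j ≤ m) :
    ∃ P, IsPair m C P ∧ #P = j ∧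
      (j < m → ∃ c ∉ P, insert c P ∈ C ∧ insert c P ⊆ Icc 1 m) := by
  induction hj using Nat.decreasingInduction with
  | self => exact ⟨Icc 1 m, H.isPair_top, by simp, fun h => absurd h (lt_irrefl m)⟩
  | of_succ k hk ih =>
    obtain ⟨P, ⟨hP, hPC, hPn⟩, hcard, -⟩ := ih
    obtain ⟨d, hd, hdC⟩ := H.exists_erase hP hPC hPn (card_pos.1 (by omega))
    obtain ⟨Q, c, h1, h2, h3, h4, h5⟩ := H.isPair_of_edge (P.erase d) d
      (by rwa [insert_erase hd]) (by simp) hdC (by rwa [insert_erase hd])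
    have := card_erase_add_one hd
    exact ⟨Q, h1, by omega, fun _ => ⟨c, h2, h3, h4⟩⟩

/-- The projection of `C` to the subsets of `[1, m]`. -/
def proj (m : ℕ) (C : Set (Finset ℕ)) : Set (Finset ℕ) :=
  {X | X ⊆ Icc 1 m ∧ X ∈ C} ∪ {Y | Y ⊆ Icc 1 m ∧ insert (m + 1) Y ∈ C}

theorem subset_Icc_of_notMem (h : X ⊆ Icc 1 (m + 1)) (hm : m + 1 ∉ X) : X ⊆ Icc 1 m := by
  intro z hz
  have := mem_Icc.1 (h hz)
  have : z ≠ m + 1 := fun h => hm (h ▸ hz)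
  rw [mem_Icc]
  omega

theorem exists_two {A B : Finset ℕ} (hc : #A = #B) {x y : ℕ} (hx : x ∈ A) (hxB : x ∉ B)
    (hy : y ∈ A) (hyB : y ∉ B) (hne : x ≠ y) (d : ℕ) : ∃ p ∈ B, p ∉ A ∧ p ≠ d := by
  by_contra! h
  have h1 : ({x, y} : Finset ℕ) ⊆ A \ B := by
    intro z hz
    grind
  have h2 : B \ A ⊆ {d} := by
    intro z hz
    grind
  have h3 := card_le_card h1
  have h4 := card_le_card h2
  rw [card_pair hne] at h3
  rw [card_singleton] at h4
  have := card_sdiff_add_card_inter A B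
  have := card_sdiff_add_card_inter B A
  rw [inter_comm] at this
  omega

theorem MaxWS.proj (H : MaxWS (m + 1) C) : MaxWS m (proj m C) := by
  have hmem : ∀ Y ⊆ Icc 1 m, m + 1 ∉ Y := fun Y h => notMem_of_subset_Icc h
  have hLR : ∀ X Y, X ⊆ Icc 1 m → X ∈ C → Y ⊆ Icc 1 m → insert (m + 1) Y ∈ C → WS X Y := by
    intro X Y hX hXC hY hYC
    rcases le_or_gt #X #Y with hc | hc
    · exact (H.prec hX hXC hY hYC hc).ws
    · exact (ws_insert_iff hX hY hc).1 (H.ws _ hXC _ hYC)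
  refine ⟨?_, ?_, ?_⟩
  · rintro A (h | h) <;> exact h.1
  · rintro A (⟨hA, hAC⟩ | ⟨hA, hAC⟩) B (⟨hB, hBC⟩ | ⟨hB, hBC⟩)
    · exact H.ws _ hAC _ hBC
    · exact hLR A B hA hAC hB hBC
    · exact (hLR B A hB hBC hA hAC).symm
    · exact (ws_insert_insert_iff (hmem A hA) (hmem B hB)).1 (H.ws _ hAC _ hBC)
  · intro Z hZ hZC
    by_contra hcon
    have hsub : Icc 1 m ⊆ Icc 1 (m + 1) := Icc_subset_Icc le_rfl (by omega)
    have hsplit : ∀ A ∈ C, (A ⊆ Icc 1 m) ∨ ∃ Y ⊆ Icc 1 m, A = insert (m + 1) Y := by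
      intro A hA
      by_cases hm : m + 1 ∈ A
      · right
        exact ⟨A.erase (m + 1), subset_Icc_of_notMem ((erase_subset _ _).trans (H.sub A hA))
          (by simp), (insert_erase hm).symm⟩
      · exact .inl (subset_Icc_of_notMem (H.sub A hA) hm)
    obtain ⟨Y, hY, hYC, hZY, hnZY⟩ :
        ∃ Y ⊆ Icc 1 m, insert (m + 1) Y ∈ C ∧ #Z ≤ #Y ∧ ¬ Prec Z Y := by
      by_contra! hc
      refine hcon (.inl ⟨hZ, H.max Z (hZ.trans hsub) fun A hA => ?_⟩)
      rcases hsplit A hA with h | ⟨Y, hY, rfl⟩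
      · exact hZC A (.inl ⟨h, hA⟩)
      · rcases le_or_gt #Z #Y with h | h
        · exact (hc Y hY hA h).ws_insert hZ h
        · exact (ws_insert_iff hZ hY h).2 (hZC Y (.inr ⟨hY, hA⟩))
    obtain ⟨X, hX, hXC, hXZ, hnXZ⟩ : ∃ X ⊆ Icc 1 m, X ∈ C ∧ #X ≤ #Z ∧ ¬ Prec X Z := by
      by_contra! hc
      refine hcon (.inr ⟨hZ, H.max _ (insert_subset (by simp) (hZ.trans hsub)) fun A hA => ?_⟩)
      rcases hsplit A hA with h | ⟨Y, hY, rfl⟩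
      · rcases le_or_gt #A #Z with h' | h'
        · exact ((hc A h hA h').ws_insert h h').symm
        · exact ((ws_insert_iff h hZ h').2 (hZC A (.inl ⟨h, hA⟩)).symm).symm
      · exact (ws_insert_insert_iff (hmem Z hZ) (hmem Y hY)).2 (hZC Y (.inr ⟨hY, hA⟩))
    have hZm : #Z ≤ m := by simpa using card_le_card hZ
    obtain ⟨P, ⟨hP, hPC, hPn⟩, hcP, hup⟩ := H.exists_isPair hZm
    have hPZ : ¬ Prec P Z := fun h => hnXZ ((H.prec hX hXC hP hPn (by omega)).trans h (by omega)
      (by omega) (hZC X (.inl ⟨hX, hXC⟩)).symm)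
    have hZP : ¬ Prec Z P := fun h => hnZY (h.trans (H.prec hP hPC hY hYC (by omega)) (by omega)
      (by omega) (hZC Y (.inr ⟨hY, hYC⟩)))
    simp only [Prec] at hPZ hZP
    push Not at hPZ hZP
    obtain ⟨p, hp, hpZ, z, hz, hzP, hzp⟩ := hPZ
    obtain ⟨z', hz', hzP', p', hp', hpZ', hpz'⟩ := hZP
    have hw : NoSurround Z P ∨ NoSurround P Z :=
      (hZC P (.inl ⟨hP, hPC⟩)).imp And.right And.right
    have hzp' : z < p := lt_of_le_of_ne hzp (by grind)
    have hpz : p' < z' := lt_of_le_of_ne hpz' (by grind)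
    rcases hw with hw | hw
    · have hq : ∀ q ∈ P, q ∉ Z → z < q ∧ q < z' := by
        intro q hq hqZ
        constructor
        · by_contra! hc
          exact hw q z p (lt_of_le_of_ne hc (by grind)) hzp' hq hqZ hz hzP hp hpZ
        · by_contra! hc
          exact hw p' z' q hpz (lt_of_le_of_ne hc (by grind)) hp' hpZ' hz' hzP' hq hqZ
      obtain ⟨d, hd, hdC⟩ := H.exists_erase hP hPC hPn ⟨p, hp⟩
      have hcard := card_erase_add_one hd
      have := hq p hp hpZ
      obtain ⟨q, hqP, hqZ, hqd⟩ := exists_two hcP.symm hz hzP hz' hzP' (by omega) d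
      have hdP := (erase_subset d P).trans hP
      have := hq q hqP hqZ
      exact ((hZC _ (.inr ⟨hdP, hdC⟩)).symm.noSurround (by omega)) z q z' this.1 this.2 hz
        (by simp [hzP]) (by simp [hqP, hqd]) hqZ hz' (by simp [hzP'])
    · have hq : ∀ q ∈ Z, q ∉ P → p' < q ∧ q < p := by
        intro q hq hqP
        constructor
        · by_contra! hc
          exact hw q p' z' (lt_of_le_of_ne hc (by grind)) hpz hq hqP hp' hpZ' hz' hzP'
        · by_contra! hc
          exact hw z p q hzp' (lt_of_le_of_ne hc (by grind)) hz hzP hp hpZ hq hqP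
      have hjm : #Z < m := by
        refine lt_of_le_of_ne hZm fun h => hpZ ?_
        rw [eq_of_subset_of_card_le hZ (by simp [h])]
        exact hP hp
      obtain ⟨c, hcP', hcC, hcI⟩ := hup hjm
      have hcard := card_insert_of_notMem hcP'
      have := hq z hz hzP
      obtain ⟨q, hqZ, hqP, hqc⟩ := exists_two hcP hp' hpZ' hp hpZ (by omega) c
      have := hq q hqZ hqP
      exact ((hZC _ (.inl ⟨hcI, hcC⟩)).noSurround (by omega)) p' q p this.1 this.2 (by simp [hp'])
        hpZ' hqZ (by simp [hqP, hqc]) (by simp [hp]) hpZ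

theorem MaxWS.finite (H : MaxWS n C) : C.Finite :=
  (Icc 1 n).powerset.finite_toSet.subset fun A hA =>
    mem_coe.2 (mem_powerset.2 (H.sub A hA))

theorem MaxWS.ncard_isPair (H : MaxWS (m + 1) C) : {P | IsPair m C P}.ncard = m + 1 := by
  have h : Set.BijOn card {P | IsPair m C P} (range (m + 1) : Set ℕ) := by
    refine ⟨fun P hP => ?_, fun P hP Q hQ hc => ?_, fun j hj => ?_⟩
    · have := card_le_card hP.1
      rw [Nat.card_Icc] at this
      simp only [coe_range, Set.mem_Iio]
      omega
    · exact (H.prec hP.1 hP.2.1 hQ.1 hQ.2.2 hc.le).antisymm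
        (H.prec hQ.1 hQ.2.1 hP.1 hP.2.2 hc.ge) hc
    · simp only [coe_range, Set.mem_Iio] at hj
      obtain ⟨P, hP, hc, -⟩ := H.exists_isPair (show j ≤ m by omega)
      exact ⟨P, hP, hc⟩
  rw [h.ncard_eq, Set.ncard_coe_finset, card_range]

theorem MaxWS.ncard_succ (H : MaxWS (m + 1) C) : C.ncard = (WSep.proj m C).ncard + (m + 1) := by
  have hL : {X | X ⊆ Icc 1 m ∧ X ∈ C}.Finite := H.finite.subset fun X h => h.2
  have hR : {Y | Y ⊆ Icc 1 m ∧ insert (m + 1) Y ∈ C}.Finite :=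
    H.proj.finite.subset Set.subset_union_right
  have hinj : Set.InjOn (insert (m + 1)) {Y | Y ⊆ Icc 1 m ∧ insert (m + 1) Y ∈ C} := by
    intro X hX Y hY h
    rw [← erase_insert (notMem_of_subset_Icc hX.1), h, erase_insert (notMem_of_subset_Icc hY.1)]
  have hC : C = {X | X ⊆ Icc 1 m ∧ X ∈ C} ∪
      insert (m + 1) '' {Y | Y ⊆ Icc 1 m ∧ insert (m + 1) Y ∈ C} := by
    ext A
    constructor
    · intro hA
      by_cases hm : m + 1 ∈ A
      · exact .inr ⟨A.erase (m + 1), ⟨subset_Icc_of_notMem ((erase_subset _ _).trans (H.sub A hA))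
          (by simp), by rwa [insert_erase hm]⟩, insert_erase hm⟩
      · exact .inl ⟨subset_Icc_of_notMem (H.sub A hA) hm, hA⟩
    · rintro (h | ⟨Y, h, rfl⟩)
      exacts [h.2, h.2]
  have hdisj : Disjoint {X | X ⊆ Icc 1 m ∧ X ∈ C}
      (insert (m + 1) '' {Y | Y ⊆ Icc 1 m ∧ insert (m + 1) Y ∈ C}) := by
    rw [Set.disjoint_left]
    rintro _ h ⟨Y, -, rfl⟩
    exact notMem_of_subset_Icc h.1 (mem_insert_self _ _)
  have hI : {X | X ⊆ Icc 1 m ∧ X ∈ C} ∩ {Y | Y ⊆ Icc 1 m ∧ insert (m + 1) Y ∈ C} =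
      {P | IsPair m C P} := by
    ext P
    simp only [Set.mem_inter_iff, Set.mem_ofPred_eq, IsPair]
    tauto
  have hcard := Set.ncard_union_add_ncard_inter _ _ hL hR
  rw [hI, H.ncard_isPair] at hcard
  rw [WSep.proj, hcard]
  conv_lhs => rw [hC]
  rw [Set.ncard_union_eq hdisj hL (hR.image _), hinj.ncard_image]

theorem MaxWS.ncard (H : MaxWS n C) : C.ncard = (n + 1).choose 2 + 1 := by
  induction n generalizing C with
  | zero =>
    have h : C = {∅} := by
      ext A
      rw [Set.mem_singleton_iff]
      constructor
      · intro hA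
        simpa using H.sub A hA
      · rintro rfl
        refine H.max ∅ (empty_subset _) fun A hA => ?_
        have : A = ∅ := by simpa using H.sub A hA
        exact this ▸ WS.refl ∅
    rw [h, Set.ncard_singleton]
    rfl
  | succ m ih =>
    rw [H.ncard_succ, ih H.proj, Nat.choose_succ_succ' (m + 1) 1, Nat.choose_one_right]
    ring

end WSep

namespace WSep

variable {n m k : ℕ} {A B X Y Z : Finset ℕ}

theorem setLT_iff (hB : ∀ b ∈ B, 0 < b) :
    SetLT A B ↔ B.Nonempty ∧ ∀ a ∈ A, ∀ b ∈ B, a < b := by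
  unfold SetLT max0 min0
  by_cases h : B.Nonempty
  · by_cases h' : A.Nonempty
    · simp only [h, h', dif_pos, true_and]
      rw [max'_lt_iff]
      simp only [lt_min'_iff]
    · rw [not_nonempty_iff_eq_empty] at h'
      subst h'
      simpa [h, lt_min'_iff] using hB
  · simp [h]

theorem pos_of_mem_sdiff (hA : ∀ a ∈ A, 0 < a) : ∀ a ∈ A \ B, 0 < a :=
  fun a ha => hA a (mem_sdiff.1 ha).1

theorem prec_of_lessDot (hB : ∀ b ∈ B, 0 < b) (h : LessDot A B) : Prec A B := by
  have := ((setLT_iff (pos_of_mem_sdiff hB)).1 h).2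
  simp only [mem_sdiff] at this
  exact fun a ha ha' b hb hb' => this a ⟨ha, ha'⟩ b ⟨hb, hb'⟩

theorem lessDot_of_prec (hB : ∀ b ∈ B, 0 < b) (hne : (B \ A).Nonempty) (h : Prec A B) :
    LessDot A B := by
  refine (setLT_iff (pos_of_mem_sdiff hB)).2 ⟨hne, fun a ha b hb => ?_⟩
  rw [mem_sdiff] at ha hb
  exact h a ha.1 ha.2 b hb.1 hb.2

theorem noSurround_of_splits (hA : ∀ a ∈ A, 0 < a) (hB : ∀ b ∈ B, 0 < b) (h : Splits A B) :
    NoSurround B A := by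
  obtain ⟨-, B', B'', -, -, hu, h1, h2⟩ := h
  have hu' : ∀ y, y ∈ B → y ∉ A → y ∈ B' ∨ y ∈ B'' := fun y hy hy' =>
    mem_union.1 (hu ▸ mem_sdiff.2 ⟨hy, hy'⟩)
  have h1 := ((setLT_iff (pos_of_mem_sdiff hA)).1 h1).2
  have hB'' : ∀ b ∈ B'', 0 < b := fun b hb =>
    hB b (mem_sdiff.1 (hu ▸ mem_union_right _ hb)).1
  have h2 := ((setLT_iff hB'').1 h2).2
  intro x y z l₁ l₂ a₁ b₁ a₂ b₂ a₃ b₃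
  rcases hu' y a₂ b₂ with h | h
  · have := h1 y h x (mem_sdiff.2 ⟨a₁, b₁⟩)
    omega
  · have := h2 z (mem_sdiff.2 ⟨a₃, b₃⟩) y h
    omega

theorem weaklySep_of_noSurround (hA : ∀ a ∈ A, 0 < a) (hB : ∀ b ∈ B, 0 < b) (hc : #A ≤ #B)
    (h : NoSurround A B) : WeaklySep A B := by
  by_cases hAB : (A \ B).Nonempty
  · obtain ⟨a, ha⟩ := hAB
    rw [mem_sdiff] at ha
    obtain ⟨b, hb, hbA⟩ := exists_sdiff hc ha.1 ha.2
    have hlow : ∀ x ∈ A, x ∉ B → x < b → ∀ y ∈ B, y ∉ A → x < y := by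
      intro x hx hxB hxb y hy hyA
      by_contra! hle
      exact h y x b (lt_of_le_of_ne hle (by grind)) hxb hy hyA hx hxB hb hbA
    have hhigh : ∀ x ∈ A, x ∉ B → b < x → ∀ y ∈ B, y ∉ A → y < x := by
      intro x hx hxB hxb y hy hyA
      by_contra! hle
      exact h b x y hxb (lt_of_le_of_ne hle (by grind)) hb hbA hx hxB hy hyA
    by_cases h1 : ∃ x ∈ A, x ∉ B ∧ x < b
    · by_cases h2 : ∃ x ∈ A, x ∉ B ∧ b < x
      · right; right
        obtain ⟨x₁, hx₁⟩ := h1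
        obtain ⟨x₂, hx₂⟩ := h2
        refine ⟨⟨⟨b, mem_sdiff.2 ⟨hb, hbA⟩⟩, {x ∈ A \ B | x < b}, {x ∈ A \ B | b < x},
          ⟨x₁, by simp [hx₁]⟩, ⟨x₂, by simp [hx₂]⟩, ?_, ?_, ?_⟩, hc⟩
        · ext x
          simp only [mem_union, mem_filter, mem_sdiff]
          have : x ∈ A → x ≠ b := fun hx h => hbA (h ▸ hx)
          grind
        · refine (setLT_iff (pos_of_mem_sdiff hB)).2 ⟨⟨b, mem_sdiff.2 ⟨hb, hbA⟩⟩, ?_⟩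
          intro x hx y hy
          rw [mem_filter, mem_sdiff] at hx
          rw [mem_sdiff] at hy
          exact hlow x hx.1.1 hx.1.2 hx.2 y hy.1 hy.2
        · refine (setLT_iff fun x hx => ?_).2 ⟨⟨x₂, by simp [hx₂]⟩, ?_⟩
          · rw [mem_filter, mem_sdiff] at hx
            exact hA x hx.1.1
          · intro y hy x hx
            rw [mem_filter, mem_sdiff] at hx
            rw [mem_sdiff] at hy
            exact hhigh x hx.1.1 hx.1.2 hx.2 y hy.1 hy.2
      · refine .inl (.inl (lessDot_of_prec hB ⟨b, mem_sdiff.2 ⟨hb, hbA⟩⟩ ?_))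
        push Not at h2
        exact fun x hx hxB => hlow x hx hxB (lt_of_le_of_ne (h2 x hx hxB) (by grind))
    · refine .inl (.inr (.inl (lessDot_of_prec hA ⟨a, mem_sdiff.2 ha⟩ ?_)))
      push Not at h1
      exact fun y hy hyA x hx hxB => hhigh x hx hxB
        (lt_of_le_of_ne (h1 x hx hxB) (by grind)) y hy hyA
  · rw [not_nonempty_iff_eq_empty, sdiff_eq_empty_iff_subset] at hAB
    rcases eq_or_ne A B with rfl | hne
    · exact .inl (.inr (.inr rfl))
    · refine .inl (.inl (lessDot_of_prec hB ?_ fun a ha ha' => absurd (hAB ha) ha'))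
      rw [sdiff_nonempty]
      exact fun h => hne (hAB.antisymm h)

theorem weaklySep_symm (h : WeaklySep A B) : WeaklySep B A := by
  rcases h with (h | h | h) | h | h
  exacts [.inl (.inr (.inl h)), .inl (.inl h), .inl (.inr (.inr h.symm)), .inr (.inr h),
    .inr (.inl h)]

theorem weaklySep_iff_ws (hA : ∀ a ∈ A, 0 < a) (hB : ∀ b ∈ B, 0 < b) :
    WeaklySep A B ↔ WS A B := by
  constructor
  · rintro ((h | h | rfl) | ⟨h, hc⟩ | ⟨h, hc⟩)
    · exact (prec_of_lessDot hB h).ws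
    · exact (prec_of_lessDot hA h).ws.symm
    · exact WS.refl A
    · exact .inr ⟨hc, noSurround_of_splits hA hB h⟩
    · exact .inl ⟨hc, noSurround_of_splits hB hA h⟩
  · rintro (⟨hc, h⟩ | ⟨hc, h⟩)
    · exact weaklySep_of_noSurround hA hB hc h
    · exact weaklySep_symm (weaklySep_of_noSurround hB hA hc h)

end WSep

namespace WSep

variable {n m k : ℕ} {A B X Y Z : Finset ℕ}

/-- `Y` is an interval. -/
def IsInterval (Y : Finset ℕ) : Prop := ∀ x y z, x < y → y < z → x ∈ Y → z ∈ Y → y ∈ Y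

/-- The complement of `Y` in `[1, n]` is an interval. -/
def IsCointerval (n : ℕ) (Y : Finset ℕ) : Prop :=
  ∀ x y z, 1 ≤ x → x < y → y < z → z ≤ n → x ∉ Y → z ∉ Y → y ∉ Y

theorem IsInterval.ws (h : IsInterval Y) (hc : #X ≤ #Y) : WS X Y :=
  .inl ⟨hc, fun x y z l₁ l₂ a₁ _ _ b₂ a₃ _ => b₂ (h x y z l₁ l₂ a₁ a₃)⟩

theorem IsCointerval.ws (h : IsCointerval n Y) (hX : X ⊆ Icc 1 n) (hc : #Y ≤ #X) : WS X Y := by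
  refine .inr ⟨hc, fun x y z l₁ l₂ a₁ b₁ a₂ _ a₃ b₃ => ?_⟩
  have := mem_Icc.1 (hX a₁)
  have := mem_Icc.1 (hX a₃)
  exact h x y z (by omega) l₁ l₂ (by omega) b₁ b₃ a₂

theorem isInterval_Icc (a b : ℕ) : IsInterval (Icc a b) := by
  intro x y z l₁ l₂ hx hz
  rw [mem_Icc] at *
  omega

theorem isCointerval_union (a b : ℕ) : IsCointerval n (Icc 1 a ∪ Icc b n) := by
  intro x y z _ l₁ l₂ _ hx hz
  simp only [mem_union, mem_Icc] at *
  omega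

theorem card_union_Icc {a b : ℕ} (hab : a < b) (hb : b ≤ n + 1) :
    #(Icc 1 a ∪ Icc b n) = a + (n + 1 - b) := by
  rw [card_union_of_disjoint, Nat.card_Icc, Nat.card_Icc]
  · omega
  · rw [disjoint_left]
    intro x h1 h2
    rw [mem_Icc] at h1 h2
    omega

/-- A nonempty set is an interval between its extremes, up to holes. -/
theorem exists_interval (hZ : ¬ IsInterval Z) :
    ∃ a b, #(Icc a b) + 1 = #Z ∧ ¬ NoSurround (Icc a b) Z ∧
      (∀ x ∈ Icc a b, ∃ u ∈ Z, ∃ v ∈ Z, u < x ∧ x < v) := by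
  simp only [IsInterval] at hZ
  push Not at hZ
  obtain ⟨x, y, z, hxy, hyz, hx, hz, hy⟩ := hZ
  have hne : Z.Nonempty := ⟨x, hx⟩
  obtain ⟨p, hp, hpmin⟩ := Z.exists_min_image id hne
  obtain ⟨q, hq, hqmax⟩ := Z.exists_max_image id hne
  simp only [id] at hpmin hqmax
  have := hpmin x hx
  have := hqmax z hz
  have h1 : Z ⊆ (Icc p q).erase y := fun w hw => by
    rw [mem_erase, mem_Icc]
    exact ⟨by grind, hpmin w hw, hqmax w hw⟩
  have h2 := card_le_card h1
  rw [card_erase_of_mem (mem_Icc.2 (by omega)), Nat.card_Icc] at h2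
  have h3 : 1 < #Z := one_lt_card.2 ⟨x, hx, z, hz, by omega⟩
  obtain ⟨a, b, ha, hay, hyb, hb, hab⟩ : ∃ a b, p < a ∧ a ≤ y ∧ y ≤ b ∧ b < q ∧ b + 2 = #Z + a := by
    rcases le_or_gt (y + #Z) (q + 1) with h | h
    · exact ⟨y, y + #Z - 2, by omega⟩
    · exact ⟨q + 1 - #Z, q - 1, by omega⟩
  refine ⟨a, b, by rw [Nat.card_Icc]; omega, fun h => ?_, fun w hw => ?_⟩
  · exact h p y q (by omega) (by omega) hp (by simp; omega) (by simp; omega) hy hq (by simp; omega)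
  · rw [mem_Icc] at hw
    exact ⟨p, hp, q, hq, by omega, by omega⟩

/-- Extremes of the complement of a set in `[1, n]`. -/
theorem exists_extremes {x : ℕ} (h1 : 1 ≤ x) (hxn : x ≤ n) (hx : x ∉ Z) :
    ∃ p q, 1 ≤ p ∧ p ≤ x ∧ x ≤ q ∧ q ≤ n ∧ p ∉ Z ∧ q ∉ Z ∧
      ∀ y, 1 ≤ y → y ≤ n → y ∉ Z → p ≤ y ∧ y ≤ q := by
  have hne : (Icc 1 n \ Z).Nonempty := ⟨x, by simp [h1, hxn, hx]⟩
  obtain ⟨p, hp, hpmin⟩ := exists_min_image _ id hne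
  obtain ⟨q, hq, hqmax⟩ := exists_max_image _ id hne
  simp only [id, mem_sdiff, mem_Icc] at hp hq hpmin hqmax
  exact ⟨p, q, hp.1.1, hpmin x (by tauto), hqmax x (by tauto), hq.1.2, hp.2, hq.2,
    fun y h1 h2 h3 => ⟨hpmin y (by tauto), hqmax y (by tauto)⟩⟩

theorem exists_cointerval (hZn : Z ⊆ Icc 1 n) (hZ : ¬ IsCointerval n Z) :
    ∃ a b, a < b ∧ b ≤ n + 1 ∧ #(Icc 1 a ∪ Icc b n) = #Z + 1 ∧
      ¬ NoSurround Z (Icc 1 a ∪ Icc b n) := by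
  simp only [IsCointerval] at hZ
  push Not at hZ
  obtain ⟨x, y, z, h1, hxy, hyz, hzn, hx, hz, hy⟩ := hZ
  obtain ⟨p, q, hp1, hpx, hxq, hqn, hp, hq, hpq⟩ := exists_extremes (n := n) h1 (by omega) hx
  have hzq := (hpq z (by omega) hzn hz).2
  have hl : insert y (Icc 1 (p - 1) ∪ Icc (q + 1) n) ⊆ Z := by
    intro w hw
    by_contra hwZ
    simp only [mem_insert, mem_union, mem_Icc] at hw
    have := hpq w
    grind
  have hu : Z ⊆ ((Icc 1 n).erase p).erase q := fun w hw =>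
    mem_erase.2 ⟨by grind, mem_erase.2 ⟨by grind, hZn hw⟩⟩
  have h3 := card_le_card hu
  rw [card_erase_of_mem (by simp; omega), card_erase_of_mem (by simp; omega), Nat.card_Icc] at h3
  have h4 := card_le_card hl
  rw [card_insert_of_notMem (by simp; omega), card_union_Icc (by omega) (by omega)] at h4
  obtain ⟨a, b, ha, hay, hyb, hb, hab⟩ : ∃ a b, p ≤ a ∧ a < y ∧ y < b ∧ b ≤ q ∧
      a + (n + 1) = #Z + 1 + b := by
    rcases le_or_gt (#Z + 1 + q) (y + n) with h | h
    · exact ⟨#Z + q - n, q, by omega⟩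
    · exact ⟨y - 1, y + n - #Z - 1, by omega⟩
  refine ⟨a, b, by omega, by omega, by rw [card_union_Icc (by omega) (by omega)]; omega,
    fun h => ?_⟩
  exact h p y q (by omega) (by omega) (by simp; omega) hp hy (by simp; omega) (by simp; omega) hq

theorem ncard_cointerval_eq (hk : k < n) :
    {X | X ⊆ Icc 1 n ∧ #X = k ∧ IsCointerval n X}.ncard = k + 1 := by
  have h : Set.BijOn (fun a => Icc 1 a ∪ Icc (n + 1 - (k - a)) n) (range (k + 1) : Set ℕ)
      {X | X ⊆ Icc 1 n ∧ #X = k ∧ IsCointerval n X} := by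
    simp only [coe_range]
    refine ⟨fun a ha => ⟨fun x hx => ?_, ?_, isCointerval_union _ _⟩, fun a ha b hb hab => ?_,
      fun X hX => ?_⟩
    · simp only [Set.mem_Iio] at ha
      simp only [mem_union, mem_Icc] at hx ⊢
      omega
    · simp only [Set.mem_Iio] at ha
      rw [card_union_Icc (by omega) (by omega)]
      omega
    · simp only [Set.mem_Iio] at ha hb
      dsimp only at hab
      have h1 := congr_arg (a + 1 ∈ ·) hab
      have h2 := congr_arg (b + 1 ∈ ·) hab
      simp only [mem_union, mem_Icc, eq_iff_iff] at h1 h2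
      omega
    · obtain ⟨hXn, hXk, hX⟩ := hX
      obtain ⟨x, hx, hxX⟩ := exists_mem_notMem_of_card_lt_card (s := X) (t := Icc 1 n)
        (by simp; omega)
      rw [mem_Icc] at hx
      obtain ⟨p, q, hp1, hpx, hxq, hqn, hp, hq, hpq⟩ := exists_extremes hx.1 hx.2 hxX
      have e : X = Icc 1 (p - 1) ∪ Icc (q + 1) n := by
        ext w
        simp only [mem_union, mem_Icc]
        constructor
        · intro hw
          have := mem_Icc.1 (hXn hw)
          by_contra hc
          have := hX p w q
          grind
        · intro hw
          by_contra hwX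
          have := hpq w
          grind
      have hc := congr_arg card e
      rw [card_union_Icc (by omega) (by omega)] at hc
      refine ⟨p - 1, by simp only [Set.mem_Iio]; omega, ?_⟩
      dsimp only
      rw [e]
      congr 2
      omega
  rw [← h.ncard_eq, Set.ncard_coe_finset, card_range]

theorem finite_of_subset_Icc {S : Set (Finset ℕ)} (h : ∀ X ∈ S, X ⊆ Icc 1 n) : S.Finite :=
  (Icc 1 n).powerset.finite_toSet.subset fun X hX => mem_coe.2 (mem_powerset.2 (h X hX))

theorem ncard_cointerval_lt (hk : k ≤ n) :
    {X | X ⊆ Icc 1 n ∧ #X < k ∧ IsCointerval n X}.ncard = (k + 1).choose 2 := by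
  induction k with
  | zero => simp
  | succ k ih =>
    have h : {X | X ⊆ Icc 1 n ∧ #X < k + 1 ∧ IsCointerval n X} =
        {X | X ⊆ Icc 1 n ∧ #X < k ∧ IsCointerval n X} ∪
          {X | X ⊆ Icc 1 n ∧ #X = k ∧ IsCointerval n X} := by
      ext X
      simp only [Set.mem_union, Set.mem_ofPred_eq, Nat.lt_succ_iff_lt_or_eq]
      tauto
    have hd : Disjoint {X | X ⊆ Icc 1 n ∧ #X < k ∧ IsCointerval n X}
        {X | X ⊆ Icc 1 n ∧ #X = k ∧ IsCointerval n X} := by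
      rw [Set.disjoint_left]
      rintro X ⟨-, h1, -⟩ ⟨-, h2, -⟩
      omega
    rw [h, Set.ncard_union_eq hd (finite_of_subset_Icc fun X hX => hX.1)
      (finite_of_subset_Icc fun X hX => hX.1), ih (by omega), ncard_cointerval_eq (by omega)]
    have := Nat.choose_succ_succ (k + 1) 1
    rw [Nat.choose_one_right] at this
    simp only [Nat.succ_eq_add_one, Nat.reduceAdd] at this
    omega

theorem IsInterval.isCointerval_sdiff (hX : IsInterval X) : IsCointerval n (Icc 1 n \ X) := by
  intro x y z h1 hxy hyz hz hx hzX hy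
  simp only [mem_sdiff, mem_Icc, not_and, not_not] at hx hzX hy
  exact hy.2 (hX x y z hxy hyz (hx (by omega)) (hzX (by omega)))

theorem IsCointerval.isInterval_sdiff (hX : IsCointerval n X) : IsInterval (Icc 1 n \ X) := by
  intro x y z hxy hyz hx hz
  simp only [mem_sdiff, mem_Icc] at hx hz ⊢
  exact ⟨by omega, hX x y z hx.1.1 hxy hyz hz.1.2 hx.2 hz.2⟩

theorem ncard_interval_gt (hm : m ≤ n) :
    {X | X ⊆ Icc 1 n ∧ m < #X ∧ IsInterval X}.ncard = (n - m + 1).choose 2 := by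
  rw [← ncard_cointerval_lt (show n - m ≤ n by omega)]
  have hsd : ∀ X ⊆ Icc 1 n, #(Icc 1 n \ X) + #X = n := fun X hX => by
    rw [card_sdiff_add_card_eq_card hX, Nat.card_Icc, Nat.add_sub_cancel]
  have h : Set.BijOn (Icc 1 n \ ·) {X | X ⊆ Icc 1 n ∧ m < #X ∧ IsInterval X}
      {X | X ⊆ Icc 1 n ∧ #X < n - m ∧ IsCointerval n X} := by
    refine ⟨fun X ⟨h1, h2, h3⟩ => ⟨sdiff_subset, ?_, h3.isCointerval_sdiff⟩,
      fun X hX Y hY h => ?_, fun X ⟨h1, h2, h3⟩ =>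
        ⟨Icc 1 n \ X, ⟨sdiff_subset, ?_, h3.isInterval_sdiff⟩, Finset.sdiff_sdiff_eq_self h1⟩⟩
    · have := hsd X h1
      dsimp only
      omega
    · dsimp only at h
      rw [← Finset.sdiff_sdiff_eq_self hX.1, h, Finset.sdiff_sdiff_eq_self hY.1]
    · have := hsd X h1
      omega
  rw [h.ncard_eq]

end WSep

namespace WSep

variable {n m k : ℕ} {A B X Y Z : Finset ℕ}

/-- The union of a collection `F` with the small cointervals and the large intervals. -/
def saturation (n k m : ℕ) (F : Finset (Finset ℕ)) : Set (Finset ℕ) :=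
  F ∪ ({X | X ⊆ Icc 1 n ∧ #X < k ∧ IsCointerval n X} ∪ {X | X ⊆ Icc 1 n ∧ m < #X ∧ IsInterval X})

theorem pos_of_subset_Icc (hX : X ⊆ Icc 1 n) : ∀ x ∈ X, 0 < x := fun _ hx =>
  (mem_Icc.1 (hX hx)).1

variable {F : Finset (Finset ℕ)}

theorem mem_of_isMaxWColl
    (hF : IsMaxWColl {X : Finset ℕ | X ⊆ Icc 1 n ∧ k ≤ #X ∧ #X ≤ m} F)
    (hZ : Z ⊆ Icc 1 n) (hk : k ≤ #Z) (hm : #Z ≤ m) (h : ∀ A ∈ F, WS Z A) : Z ∈ F := by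
  obtain ⟨hD, hw, hmax⟩ := hF
  have hpos : ∀ A ∈ F, ∀ a ∈ A, 0 < a := fun A hA => pos_of_subset_Icc (hD hA).1
  have hZpos := pos_of_subset_Icc hZ
  rw [hmax (insert Z F) ?_ ?_ (subset_insert Z F)]
  · exact mem_insert_self Z F
  · rw [coe_insert]
    exact Set.insert_subset ⟨hZ, hk, hm⟩ hD
  · intro A hA B hB
    rw [mem_insert] at hA hB
    rcases hA with rfl | hA <;> rcases hB with rfl | hB
    · exact (weaklySep_iff_ws hZpos hZpos).2 (WS.refl _)
    · exact (weaklySep_iff_ws hZpos (hpos B hB)).2 (h B hB)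
    · exact (weaklySep_iff_ws (hpos A hA) hZpos).2 (h A hA).symm
    · exact hw A hA B hB

theorem maxWS_saturation (hkm : k ≤ m)
    (hF : IsMaxWColl {X : Finset ℕ | X ⊆ Icc 1 n ∧ k ≤ #X ∧ #X ≤ m} F) :
    MaxWS n (saturation n k m F) := by
  have hD := hF.1
  refine ⟨?_, ?_, fun Z hZ h => ?_⟩
  · rintro X (hX | hX | hX)
    exacts [(hD hX).1, hX.1, hX.1]
  · rintro X (hX | hX | hX) Y (hY | hY | hY)
    · exact (weaklySep_iff_ws (pos_of_subset_Icc (hD hX).1) (pos_of_subset_Icc (hD hY).1)).1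
        (hF.2.1 X hX Y hY)
    · exact hY.2.2.ws (hD hX).1 (hY.2.1.le.trans (hD hX).2.1)
    · exact hY.2.2.ws ((hD hX).2.2.trans hY.2.1.le)
    · exact (hX.2.2.ws (hD hY).1 (hX.2.1.le.trans (hD hY).2.1)).symm
    · rcases le_total #X #Y with hc | hc
      · exact (hX.2.2.ws hY.1 hc).symm
      · exact hY.2.2.ws hX.1 hc
    · exact hY.2.2.ws ((hX.2.1.trans_le hkm).trans hY.2.1).le
    · exact (hX.2.2.ws ((hD hY).2.2.trans hX.2.1.le)).symm
    · exact (hX.2.2.ws ((hY.2.1.trans_le hkm).trans hX.2.1).le).symm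
    · rcases le_total #X #Y with hc | hc
      · exact hY.2.2.ws hc
      · exact (hX.2.2.ws hc).symm
  rcases lt_or_ge #Z k with hk | hk
  · refine .inr (.inl ⟨hZ, hk, ?_⟩)
    by_contra hI
    obtain ⟨a, b, hab, hb, hc, hs⟩ := exists_cointerval hZ hI
    have hQ := isCointerval_union (n := n) a b
    have hQn : Icc 1 a ∪ Icc b n ⊆ Icc 1 n := fun x hx => by
      simp only [mem_union, mem_Icc] at hx ⊢
      omega
    refine hs ((h _ ?_).noSurround (by omega))
    rcases (Nat.succ_le_of_lt hk).lt_or_eq with h1 | h1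
    · exact .inr (.inl ⟨hQn, by omega, hQ⟩)
    · exact .inl (mem_of_isMaxWColl hF hQn (by omega) (by omega) fun A hA =>
        (hQ.ws (hD hA).1 (by have := (hD hA).2.1; omega)).symm)
  rcases le_or_gt #Z m with hm | hm
  · exact .inl (mem_of_isMaxWColl hF hZ hk hm fun A hA => h A (.inl hA))
  · refine .inr (.inr ⟨hZ, hm, ?_⟩)
    by_contra hI
    obtain ⟨a, b, hc, hs, hab⟩ := exists_interval hI
    have hQ := isInterval_Icc a b
    have hQn : Icc a b ⊆ Icc 1 n := fun x hx => by
      obtain ⟨u, hu, v, hv, h1, h2⟩ := hab x hx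
      have := mem_Icc.1 (hZ hu)
      have := mem_Icc.1 (hZ hv)
      exact mem_Icc.2 (by omega)
    refine hs ((h _ ?_).symm.noSurround (by omega))
    rcases (Nat.le_of_lt_succ (hc ▸ hm)).lt_or_eq with h1 | h1
    · exact .inr (.inr ⟨hQn, by omega, hQ⟩)
    · exact .inl (mem_of_isMaxWColl hF hQn (by omega) (by omega) fun A hA =>
        (hQ.ws (by have := (hD hA).2.2; omega)).symm)

theorem card_of_isMaxWColl (hkm : k ≤ m) (hmn : m ≤ n)
    (hF : IsMaxWColl {X : Finset ℕ | X ⊆ Icc 1 n ∧ k ≤ #X ∧ #X ≤ m} F) :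
    #F = (n + 1).choose 2 - (n - m + 1).choose 2 - (k + 1).choose 2 + 1 := by
  have hD := hF.1
  have h := (maxWS_saturation hkm hF).ncard
  have hd₁ : Disjoint {X | X ⊆ Icc 1 n ∧ #X < k ∧ IsCointerval n X}
      {X | X ⊆ Icc 1 n ∧ m < #X ∧ IsInterval X} := by
    rw [Set.disjoint_left]
    rintro X ⟨-, h1, -⟩ ⟨-, h2, -⟩
    omega
  have hd₂ : Disjoint (F : Set (Finset ℕ)) ({X | X ⊆ Icc 1 n ∧ #X < k ∧ IsCointerval n X} ∪
      {X | X ⊆ Icc 1 n ∧ m < #X ∧ IsInterval X}) := by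
    rw [Set.disjoint_left]
    rintro X hX (⟨-, h1, -⟩ | ⟨-, h1, -⟩)
    · have := (hD hX).2.1
      omega
    · have := (hD hX).2.2
      omega
  have hf₁ := finite_of_subset_Icc (S := {X | X ⊆ Icc 1 n ∧ #X < k ∧ IsCointerval n X})
    fun X hX => hX.1
  have hf₂ := finite_of_subset_Icc (S := {X | X ⊆ Icc 1 n ∧ m < #X ∧ IsInterval X})
    fun X hX => hX.1
  rw [saturation, Set.ncard_union_eq hd₂ F.finite_toSet (hf₁.union hf₂),
    Set.ncard_union_eq hd₁ hf₁ hf₂, Set.ncard_coe_finset, ncard_cointerval_lt (hkm.trans hmn),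
    ncard_interval_gt hmn] at h
  have hne : 0 < #F := by
    rw [card_pos, nonempty_iff_ne_empty]
    rintro rfl
    have := mem_of_isMaxWColl (Z := Icc 1 k) hF (Icc_subset_Icc_right (hkm.trans hmn))
      (by simp) (by simpa using hkm) (by simp)
    simp at this
  omega

end WSep

/-- for `0 ≤ m′ ≤ m ≤ n`, the domain `Δ_n^{m′,m}` is w-pure, with
w-rank `C(n+1,2) − C(n−m+1,2) − C(m′+1,2) + 1`. -/
theorem hypersimplex_range_w_pure (n m' m : ℕ) (hn : 1 ≤ n) (h1 : m' ≤ m) (h2 : m ≤ n) :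
    WPure {X : Finset ℕ | X ⊆ Finset.Icc 1 n ∧ m' ≤ X.card ∧ X.card ≤ m} ∧
    ∀ F : Finset (Finset ℕ),
      IsMaxWColl {X : Finset ℕ | X ⊆ Finset.Icc 1 n ∧ m' ≤ X.card ∧ X.card ≤ m} F →
      F.card = (n + 1).choose 2 - (n - m + 1).choose 2 - (m' + 1).choose 2 + 1 := by
  exact ⟨fun F G hF hG => by
    rw [WSep.card_of_isMaxWColl h1 h2 hF, WSep.card_of_isMaxWColl h1 h2 hG],
    fun F hF => WSep.card_of_isMaxWColl h1 h2 hF⟩
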